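/- arXiv:2501.15221 — 4 statements merged into one kernel-verified Lean document; each statement's English description precedes it below -/
import Mathlib

section
/- Let A ∈ ℝ^{m×n}, y ∈ ℝ^m, T ⊆ {1,…,n}, λ > 0. If (û, v̂) ∈ ℝⁿ×ℝⁿ is a local minimizer of g(u,v) = ½‖A(u∘v) − y‖₂² + (λ/2)(‖u_{T^c}‖₂² + ‖v_{T^c}‖₂²), then ẑ := û∘v̂ is a global minimizer of f(z) = ½‖Az − y‖₂² + λ‖z_{T^c}‖₁. -/
open scoped BigOperators

/-- The ℓ₁ norm of the restriction of a vector to an index set `S`. -/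
def l1normOn {n : ℕ} (S : Finset (Fin n)) (x : Fin n → ℝ) : ℝ := ∑ i ∈ S, |x i|

/-- The tail-lasso objective `f(z) = ½‖Az − y‖₂² + λ‖z_{Tᶜ}‖₁`. -/
noncomputable def tailLasso {m n : ℕ} (A : Matrix (Fin m) (Fin n) ℝ) (y : Fin m → ℝ)
    (T : Finset (Fin n)) (lam : ℝ) (z : Fin n → ℝ) : ℝ :=
  (∑ i, (A.mulVec z i - y i) ^ 2) / 2 + lam * l1normOn Tᶜ z

/-- The Hadamard product parametrization objective, as a function of the pair `(u, v)`. -/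
noncomputable def hppObj {m n : ℕ} (A : Matrix (Fin m) (Fin n) ℝ) (y : Fin m → ℝ)
    (T : Finset (Fin n)) (lam : ℝ) (p : (Fin n → ℝ) × (Fin n → ℝ)) : ℝ :=
  (∑ i, (A.mulVec (fun j => p.1 j * p.2 j) i - y i) ^ 2) / 2
    + lam / 2 * ((∑ j ∈ Tᶜ, p.1 j ^ 2) + ∑ j ∈ Tᶜ, p.2 j ^ 2)

lemma aux_L0 {α β ε : ℝ} (hε : 0 < ε) (h : ∀ t, 0 < t → t < ε → 0 ≤ α + β * t) : 0 ≤ α := by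
  by_contra hα
  push Not at hα
  have hb : 0 < 2 * (|β| + 1) := by positivity
  have hpos : 0 < -α / (2 * (|β| + 1)) := div_pos (by linarith) hb
  set t := min (ε / 2) (-α / (2 * (|β| + 1))) with ht
  have ht0 : 0 < t := lt_min (by linarith) hpos
  have ht1 : t < ε := lt_of_le_of_lt (min_le_left _ _) (by linarith)
  have ht2 : t * (2 * (|β| + 1)) ≤ -α := (le_div_iff₀ hb).1 (min_le_right _ _)
  have h1 := h t ht0 ht1
  have h2 : β * t ≤ |β| * t := mul_le_mul_of_nonneg_right (le_abs_self β) ht0.le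
  nlinarith

lemma aux_L1 {α β ε : ℝ} (hε : 0 < ε) (h : ∀ t, |t| < ε → 0 ≤ α * t + β * t ^ 2) : α = 0 := by
  apply le_antisymm
  · have : 0 ≤ -α := by
      refine aux_L0 (β := β) hε fun t h0 h1 => ?_
      have := h (-t) (by rw [abs_neg, abs_of_pos h0]; exact h1)
      have : 0 ≤ t * (-α + β * t) := by nlinarith
      exact nonneg_of_mul_nonneg_right this h0
    linarith
  · refine aux_L0 (β := β) hε fun t h0 h1 => ?_
    have := h t (by rw [abs_of_pos h0]; exact h1)
    have : 0 ≤ t * (α + β * t) := by nlinarith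
    exact nonneg_of_mul_nonneg_right this h0

lemma aux_L2 {α β ε : ℝ} (hε : 0 < ε) (hβ : 0 ≤ β)
    (h : ∀ t, |t| < ε → 0 ≤ α * t ^ 2 + β * t ^ 4) : 0 ≤ α := by
  refine aux_L0 (β := β * ε) hε fun t h0 h1 => ?_
  have h2 := h t (by rw [abs_of_pos h0]; exact h1)
  have h3 : 0 ≤ t ^ 2 * (α + β * t ^ 2) := by nlinarith
  have h4 : 0 ≤ α + β * t ^ 2 := nonneg_of_mul_nonneg_right h3 (by positivity)
  have : β * t ^ 2 ≤ β * (ε * t) := mul_le_mul_of_nonneg_left (by nlinarith) hβ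
  linarith

lemma aux_scalar {c K μ p0 q0 ε : ℝ} (hε : 0 < ε) (hK : 0 ≤ K) (hμ : 0 ≤ μ)
    (h : ∀ p q, |p - p0| < ε → |q - q0| < ε →
      0 ≤ c * (p * q - p0 * q0) + K / 2 * (p * q - p0 * q0) ^ 2
        + μ / 2 * ((p ^ 2 - p0 ^ 2) + (q ^ 2 - q0 ^ 2))) (z : ℝ) :
    0 ≤ c * (z - p0 * q0) + μ * (|z| - |p0 * q0|) := by
  have e1 : c * q0 + μ * p0 = 0 := by
    refine aux_L1 (β := K / 2 * q0 ^ 2 + μ / 2) hε fun t ht => ?_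
    have := h (p0 + t) q0 (by simpa using ht) (by simpa using hε)
    nlinarith
  have e2 : c * p0 + μ * q0 = 0 := by
    refine aux_L1 (β := K / 2 * p0 ^ 2 + μ / 2) hε fun t ht => ?_
    have := h p0 (q0 + t) (by simpa using hε) (by simpa using ht)
    nlinarith
  have key : |c| ≤ μ ∧ c * (p0 * q0) + μ * |p0 * q0| ≤ 0 := by
    by_cases h0 : p0 = 0 ∧ q0 = 0
    · obtain ⟨rfl, rfl⟩ := h0
      refine ⟨abs_le.2 ⟨?_, ?_⟩, by simp⟩
      · have : 0 ≤ c + μ := by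
          refine aux_L2 (β := K / 2) hε (by linarith) fun t ht => ?_
          have := h t t (by simpa using ht) (by simpa using ht)
          nlinarith
        linarith
      · have : 0 ≤ -c + μ := by
          refine aux_L2 (β := K / 2) hε (by linarith) fun t ht => ?_
          have := h t (-t) (by simpa using ht) (by simpa using ht)
          nlinarith
        linarith
    · have hs : 0 < p0 ^ 2 + q0 ^ 2 := by
        by_contra hn
        apply h0
        constructor <;> nlinarith [sq_nonneg p0, sq_nonneg q0]
      have hc : c ^ 2 = μ ^ 2 := by
        have : (c ^ 2 - μ ^ 2) * (p0 ^ 2 + q0 ^ 2) = 0 := by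
          linear_combination (c * q0 - μ * p0) * e1 + (c * p0 - μ * q0) * e2
        rcases mul_eq_zero.1 this with h | h <;> linarith
      refine ⟨abs_le_of_sq_le_sq hc.le hμ, ?_⟩
      have a1 : c * (p0 * q0) = - (μ * p0 ^ 2) := by linear_combination p0 * e1
      have a2 : c * (p0 * q0) = - (μ * q0 ^ 2) := by linear_combination q0 * e2
      have : |p0 * q0| ≤ (p0 ^ 2 + q0 ^ 2) / 2 := by
        rw [abs_le]; constructor <;> nlinarith [sq_nonneg (p0 + q0), sq_nonneg (p0 - q0)]
      nlinarith [mul_le_mul_of_nonneg_left this hμ]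
  obtain ⟨k1, k2⟩ := key
  have k3 : -(c * z) ≤ μ * |z| := by
    calc -(c * z) ≤ |c * z| := neg_le_abs _
      _ = |c| * |z| := abs_mul _ _
      _ ≤ _ := mul_le_mul_of_nonneg_right k1 (abs_nonneg _)
  linarith

lemma aux_upd {n : ℕ} (S : Finset (Fin n)) (u : Fin n → ℝ) (j : Fin n) (p : ℝ) :
    ∑ k ∈ S, (Function.update u j p k) ^ 2
      = ∑ k ∈ S, u k ^ 2 + if j ∈ S then p ^ 2 - u j ^ 2 else 0 := by
  rw [← Finset.sum_ite_eq S j (fun _ => p ^ 2 - u j ^ 2), ← Finset.sum_add_distrib]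
  refine Finset.sum_congr rfl fun k _ => ?_
  by_cases hk : k = j
  · subst hk; simp
  · simp [hk, Ne.symm hk]

lemma aux_coord {m n : ℕ} (A : Matrix (Fin m) (Fin n) ℝ) (y : Fin m → ℝ)
    (T : Finset (Fin n)) (lam : ℝ) (u v : Fin n → ℝ) (j : Fin n) (p q : ℝ) :
    hppObj A y T lam (Function.update u j p, Function.update v j q) - hppObj A y T lam (u, v)
     = (∑ i, (A.mulVec (fun k => u k * v k) i - y i) * A i j) * (p * q - u j * v j)
      + (∑ i, A i j ^ 2) / 2 * (p * q - u j * v j) ^ 2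
      + (if j ∈ Tᶜ then lam else 0) / 2 * ((p ^ 2 - u j ^ 2) + (q ^ 2 - v j ^ 2)) := by
  have hw : (fun k => Function.update u j p k * Function.update v j q k)
      = (fun k => u k * v k) + Pi.single j (p * q - u j * v j) := by
    funext k
    by_cases hk : k = j
    · subst hk; simp
    · simp [hk]
  simp only [hppObj, hw, aux_upd, Matrix.mulVec_add, Pi.add_apply]
  have hs : ∀ i, (A.mulVec (Pi.single j (p * q - u j * v j))) i = A i j * (p * q - u j * v j) := by
    intro i; simp
  simp only [hs]
  have : ∑ i, (A.mulVec (fun k => u k * v k) i + A i j * (p * q - u j * v j) - y i) ^ 2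
     = ∑ i, (A.mulVec (fun k => u k * v k) i - y i) ^ 2
      + 2 * (∑ i, (A.mulVec (fun k => u k * v k) i - y i) * A i j) * (p * q - u j * v j)
      + (∑ i, A i j ^ 2) * (p * q - u j * v j) ^ 2 := by
    rw [Finset.mul_sum, Finset.sum_mul, Finset.sum_mul, ← Finset.sum_add_distrib,
      ← Finset.sum_add_distrib]
    exact Finset.sum_congr rfl fun i _ => by ring
  rw [this]
  split_ifs <;> ring

theorem stmt10 {m n : ℕ} (A : Matrix (Fin m) (Fin n) ℝ) (y : Fin m → ℝ)
    (T : Finset (Fin n)) (lam : ℝ) (hlam : 0 < lam)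
    (uhat vhat : Fin n → ℝ)
    (hloc : IsLocalMin (hppObj A y T lam) (uhat, vhat)) :
    ∀ z : Fin n → ℝ,
      tailLasso A y T lam (fun j => uhat j * vhat j) ≤ tailLasso A y T lam z := by
  intro z
  set w : Fin n → ℝ := fun j => uhat j * vhat j with hw
  have hj : ∀ j, 0 ≤ (∑ i, (A.mulVec w i - y i) * A i j) * (z j - w j)
      + (if j ∈ Tᶜ then lam else 0) * (|z j| - |w j|) := by
    intro j
    have hcont : Continuous (fun x : ℝ × ℝ =>
        (Function.update uhat j x.1, Function.update vhat j x.2)) :=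
      ((continuous_const (y := uhat)).update j continuous_fst).prodMk
        ((continuous_const (y := vhat)).update j continuous_snd)
    have ht := hcont.tendsto (uhat j, vhat j)
    simp only [Function.update_eq_self] at ht
    have hev := ht.eventually hloc
    obtain ⟨ε, hε, hball⟩ := Metric.eventually_nhds_iff.1 hev
    refine aux_scalar (K := ∑ i, A i j ^ 2) hε (Finset.sum_nonneg fun i _ => sq_nonneg _)
      (by split_ifs <;> linarith) (fun p q hp hq => ?_) (z j)
    have h1 := hball (y := (p, q)) (by
      rw [Prod.dist_eq]; exact max_lt (by simpa [Real.dist_eq] using hp)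
        (by simpa [Real.dist_eq] using hq))
    rw [← aux_coord A y T lam uhat vhat j p q]
    exact sub_nonneg.2 h1
  have hsum := Finset.sum_nonneg fun j (_ : j ∈ Finset.univ) => hj j
  rw [Finset.sum_add_distrib] at hsum
  have s1 : ∑ j, (∑ i, (A.mulVec w i - y i) * A i j) * (z j - w j)
      = ∑ i, (A.mulVec w i - y i) * (A.mulVec z i - A.mulVec w i) := by
    simp only [Finset.sum_mul]
    rw [Finset.sum_comm]
    refine Finset.sum_congr rfl fun i _ => ?_
    rw [← Pi.sub_apply (A.mulVec z) (A.mulVec w), ← Matrix.mulVec_sub]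
    simp only [Matrix.mulVec, dotProduct, Finset.mul_sum, Pi.sub_apply, mul_assoc]
  have s2 : ∑ j, (if j ∈ Tᶜ then lam else 0) * (|z j| - |w j|)
      = lam * l1normOn Tᶜ z - lam * l1normOn Tᶜ w := by
    simp only [l1normOn, ← mul_sub, ← Finset.sum_sub_distrib, ite_mul, zero_mul, Finset.mul_sum]
    rw [Finset.sum_ite_mem, Finset.univ_inter]
  have s3 : ∑ i, (A.mulVec w i - y i) * (A.mulVec z i - A.mulVec w i)
      ≤ (∑ i, (A.mulVec z i - y i) ^ 2) / 2 - (∑ i, (A.mulVec w i - y i) ^ 2) / 2 := by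
    rw [Finset.sum_div, Finset.sum_div, ← Finset.sum_sub_distrib]
    refine Finset.sum_le_sum fun i _ => ?_
    nlinarith [sq_nonneg (A.mulVec z i - A.mulVec w i)]
  unfold tailLasso
  linarith
end

section
/- Let A ∈ ℝ^{m×n}, y ∈ ℝ^m, T ⊆ {1,…,n}, λ > 0. If (û, v̂) ∈ ℝⁿ×ℝⁿ satisfies ∇g(û, v̂) = 0 and ∇²g(û, v̂) ⪰ 0 (the Hessian of g at (û, v̂) is positive semidefinite), then (û, v̂) is a global minimizer of g. Consequently, g has no spurious local minima (every local minimizer is global) and every saddle point of g has a direction of strictly negative curvature. -/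
open scoped BigOperators

/-- The Hessian of `hppObj` at a point, as a bilinear form evaluated on a pair of directions. -/
noncomputable def hppHess {m n : ℕ} (A : Matrix (Fin m) (Fin n) ℝ) (y : Fin m → ℝ)
    (T : Finset (Fin n)) (lam : ℝ) (p d d' : (Fin n → ℝ) × (Fin n → ℝ)) : ℝ :=
  fderiv ℝ (fun q => fderiv ℝ (hppObj A y T lam) q d) p d'

theorem hpp_line {n : ℕ} {f : (Fin n → ℝ) × (Fin n → ℝ) → ℝ} (hf : Differentiable ℝ f)
    (q d : (Fin n → ℝ) × (Fin n → ℝ)) (c1 c2 c3 c4 : ℝ)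
    (h : ∀ t : ℝ, f (q + t • d) = f q + t * c1 + t ^ 2 * c2 + t ^ 3 * c3 + t ^ 4 * c4) :
    fderiv ℝ f q d = c1 := by
  have h1 := ((hf q).hasFDerivAt.hasLineDerivAt d)
  have h2 : HasDerivAt (fun t : ℝ => f (q + t • d)) c1 0 := by
    rw [funext h]
    have e := hasDerivAt_id (0 : ℝ)
    have := ((((e.mul_const c1).const_add (f q)).add ((e.pow 2).mul_const c2)).add
      ((e.pow 3).mul_const c3)).add ((e.pow 4).mul_const c4)
    exact this.congr_deriv (by simp)
  exact HasDerivAt.unique h1 h2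

theorem hpp_mulVec_lin {m n : ℕ} (A : Matrix (Fin m) (Fin n) ℝ) (x c e : Fin n → ℝ) (t s : ℝ)
    (w : Fin n → ℝ) (hw : ∀ j, w j = x j + t * c j + s * e j) (i : Fin m) :
    A.mulVec w i = A.mulVec x i + t * A.mulVec c i + s * A.mulVec e i := by
  simp only [Matrix.mulVec, dotProduct, Finset.mul_sum, ← Finset.sum_add_distrib, hw]
  exact Finset.sum_congr rfl fun j _ => by ring

noncomputable def hppG {m n : ℕ} (A : Matrix (Fin m) (Fin n) ℝ) (y : Fin m → ℝ)
    (T : Finset (Fin n)) (lam : ℝ) (p d : (Fin n → ℝ) × (Fin n → ℝ)) : ℝ :=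
  (∑ i, (A.mulVec (fun j => p.1 j * p.2 j) i - y i) *
      A.mulVec (fun j => p.1 j * d.2 j + p.2 j * d.1 j) i)
    + lam * ∑ j ∈ Tᶜ, (p.1 j * d.1 j + p.2 j * d.2 j)

noncomputable def hppH {m n : ℕ} (A : Matrix (Fin m) (Fin n) ℝ) (y : Fin m → ℝ)
    (T : Finset (Fin n)) (lam : ℝ) (p d : (Fin n → ℝ) × (Fin n → ℝ)) : ℝ :=
  (∑ i, (A.mulVec (fun j => p.1 j * d.2 j + p.2 j * d.1 j) i ^ 2 +
      2 * ((A.mulVec (fun j => p.1 j * p.2 j) i - y i) * A.mulVec (fun j => d.1 j * d.2 j) i)))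
    + lam * ∑ j ∈ Tᶜ, (d.1 j ^ 2 + d.2 j ^ 2)

theorem hppObj_expand {m n : ℕ} (A : Matrix (Fin m) (Fin n) ℝ) (y : Fin m → ℝ)
    (T : Finset (Fin n)) (lam : ℝ) (p d : (Fin n → ℝ) × (Fin n → ℝ)) (t : ℝ) :
    hppObj A y T lam (p + t • d) = hppObj A y T lam p + t * hppG A y T lam p d
      + t ^ 2 * (hppH A y T lam p d / 2)
      + t ^ 3 * (∑ i, A.mulVec (fun j => p.1 j * d.2 j + p.2 j * d.1 j) i *
          A.mulVec (fun j => d.1 j * d.2 j) i)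
      + t ^ 4 * ((∑ i, A.mulVec (fun j => d.1 j * d.2 j) i ^ 2) / 2) := by
  have h := hpp_mulVec_lin A (fun j => p.1 j * p.2 j) (fun j => p.1 j * d.2 j + p.2 j * d.1 j)
    (fun j => d.1 j * d.2 j) t (t ^ 2) (fun j => (p + t • d).1 j * (p + t • d).2 j)
    (fun j => by simp; ring)
  unfold hppObj hppG hppH
  simp only [h]
  generalize A.mulVec (fun j => p.1 j * p.2 j) = X
  generalize A.mulVec (fun j => p.1 j * d.2 j + p.2 j * d.1 j) = C
  generalize A.mulVec (fun j => d.1 j * d.2 j) = E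
  have e1 : ∑ i, (X i + t * C i + t ^ 2 * E i - y i) ^ 2 = (∑ i, (X i - y i) ^ 2)
      + 2 * t * (∑ i, (X i - y i) * C i) + t ^ 2 * (∑ i, (C i ^ 2 + 2 * ((X i - y i) * E i)))
      + 2 * t ^ 3 * (∑ i, C i * E i) + t ^ 4 * ∑ i, E i ^ 2 := by
    simp only [Finset.mul_sum, ← Finset.sum_add_distrib]
    exact Finset.sum_congr rfl fun j _ => by ring
  have e2 : (∑ j ∈ Tᶜ, (p + t • d).1 j ^ 2) + ∑ j ∈ Tᶜ, (p + t • d).2 j ^ 2 =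
      ((∑ j ∈ Tᶜ, p.1 j ^ 2) + ∑ j ∈ Tᶜ, p.2 j ^ 2)
      + 2 * t * (∑ j ∈ Tᶜ, (p.1 j * d.1 j + p.2 j * d.2 j))
      + t ^ 2 * ∑ j ∈ Tᶜ, (d.1 j ^ 2 + d.2 j ^ 2) := by
    simp only [Finset.mul_sum, ← Finset.sum_add_distrib]
    exact Finset.sum_congr rfl fun j _ => by simp; ring
  rw [e1, e2]; ring

theorem hppG_expand {m n : ℕ} (A : Matrix (Fin m) (Fin n) ℝ) (y : Fin m → ℝ)
    (T : Finset (Fin n)) (lam : ℝ) (p d : (Fin n → ℝ) × (Fin n → ℝ)) (t : ℝ) :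
    hppG A y T lam (p + t • d) d = hppG A y T lam p d + t * hppH A y T lam p d
      + t ^ 2 * (3 * ∑ i, A.mulVec (fun j => p.1 j * d.2 j + p.2 j * d.1 j) i *
          A.mulVec (fun j => d.1 j * d.2 j) i)
      + t ^ 3 * (2 * ∑ i, A.mulVec (fun j => d.1 j * d.2 j) i ^ 2) + t ^ 4 * 0 := by
  have h := hpp_mulVec_lin A (fun j => p.1 j * p.2 j) (fun j => p.1 j * d.2 j + p.2 j * d.1 j)
    (fun j => d.1 j * d.2 j) t (t ^ 2) (fun j => (p + t • d).1 j * (p + t • d).2 j)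
    (fun j => by simp; ring)
  have h' := hpp_mulVec_lin A (fun j => p.1 j * d.2 j + p.2 j * d.1 j)
    (fun j => d.1 j * d.2 j) 0 (2 * t) 0
    (fun j => (p + t • d).1 j * d.2 j + (p + t • d).2 j * d.1 j)
    (fun j => by simp; ring)
  unfold hppG hppH
  simp only [h, h']
  generalize A.mulVec (fun j => p.1 j * p.2 j) = X
  generalize A.mulVec (fun j => p.1 j * d.2 j + p.2 j * d.1 j) = C
  generalize A.mulVec (fun j => d.1 j * d.2 j) = E
  have e2 : ∑ j ∈ Tᶜ, ((p + t • d).1 j * d.1 j + (p + t • d).2 j * d.2 j) =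
      (∑ j ∈ Tᶜ, (p.1 j * d.1 j + p.2 j * d.2 j))
      + t * ∑ j ∈ Tᶜ, (d.1 j ^ 2 + d.2 j ^ 2) := by
    simp only [Finset.mul_sum, ← Finset.sum_add_distrib]
    exact Finset.sum_congr rfl fun j _ => by simp; ring
  have e1 : ∑ i, (X i + t * C i + t ^ 2 * E i - y i) *
        (C i + 2 * t * E i + 0 * A.mulVec 0 i) = 
      (∑ i, (X i - y i) * C i) + t * (∑ i, (C i ^ 2 + 2 * ((X i - y i) * E i)))
      + t ^ 2 * (3 * ∑ i, C i * E i) + t ^ 3 * (2 * ∑ i, E i ^ 2) := by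
    simp only [Finset.mul_sum, ← Finset.sum_add_distrib]
    exact Finset.sum_congr rfl fun j _ => by ring
  rw [e1, e2]; ring

theorem hppObj_diff {m n : ℕ} (A : Matrix (Fin m) (Fin n) ℝ) (y : Fin m → ℝ)
    (T : Finset (Fin n)) (lam : ℝ) : Differentiable ℝ (hppObj A y T lam) := by
  unfold hppObj Matrix.mulVec dotProduct
  fun_prop

theorem hppG_diff {m n : ℕ} (A : Matrix (Fin m) (Fin n) ℝ) (y : Fin m → ℝ)
    (T : Finset (Fin n)) (lam : ℝ) (d) : Differentiable ℝ (fun p => hppG A y T lam p d) := by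
  unfold hppG Matrix.mulVec dotProduct
  fun_prop

theorem hpp_fderiv {m n : ℕ} (A : Matrix (Fin m) (Fin n) ℝ) (y : Fin m → ℝ)
    (T : Finset (Fin n)) (lam : ℝ) (p d : (Fin n → ℝ) × (Fin n → ℝ)) :
    fderiv ℝ (hppObj A y T lam) p d = hppG A y T lam p d :=
  hpp_line (hppObj_diff A y T lam) p d _ _ _ _ (hppObj_expand A y T lam p d)

theorem hppHess_eq {m n : ℕ} (A : Matrix (Fin m) (Fin n) ℝ) (y : Fin m → ℝ)
    (T : Finset (Fin n)) (lam : ℝ) (p d : (Fin n → ℝ) × (Fin n → ℝ)) :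
    hppHess A y T lam p d d = hppH A y T lam p d := by
  unfold hppHess
  simp only [hpp_fderiv]
  exact hpp_line (hppG_diff A y T lam d) p d _ _ _ _ (hppG_expand A y T lam p d)

theorem hpp_local {m n : ℕ} (A : Matrix (Fin m) (Fin n) ℝ) (y : Fin m → ℝ)
    (T : Finset (Fin n)) (lam : ℝ) (p d : (Fin n → ℝ) × (Fin n → ℝ))
    (h : IsLocalMin (hppObj A y T lam) p) : 0 ≤ hppH A y T lam p d := by
  have h0 : hppG A y T lam p d = 0 := by
    rw [← hpp_fderiv, h.fderiv_eq_zero]; rfl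
  have hc : Filter.Tendsto (fun t : ℝ => p + t • d) (nhdsWithin 0 {0}ᶜ) (nhds p) := by
    have : Continuous (fun t : ℝ => p + t • d) := by fun_prop
    have := this.tendsto 0
    simp only [zero_smul, add_zero] at this
    exact this.mono_left nhdsWithin_le_nhds
  have hev := hc.eventually h
  have hx := hppObj_expand A y T lam p d
  rw [h0] at hx
  generalize (∑ i, A.mulVec (fun j => p.1 j * d.2 j + p.2 j * d.1 j) i *
          A.mulVec (fun j => d.1 j * d.2 j) i) = c3 at hx
  generalize ((∑ i, A.mulVec (fun j => d.1 j * d.2 j) i ^ 2) / 2) = c4 at hx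
  have ht : Filter.Tendsto (fun t : ℝ => hppH A y T lam p d / 2 + t * c3 + t ^ 2 * c4)
      (nhdsWithin 0 {0}ᶜ) (nhds (hppH A y T lam p d / 2)) := by
    have : Continuous (fun t : ℝ => hppH A y T lam p d / 2 + t * c3 + t ^ 2 * c4) := by fun_prop
    have := this.tendsto 0
    simp only [zero_mul, add_zero, ne_eq, OfNat.ofNat_ne_zero, not_false_eq_true,
      zero_pow] at this
    exact this.mono_left nhdsWithin_le_nhds
  have : 0 ≤ hppH A y T lam p d / 2 := by
    refine ge_of_tendsto ht ?_
    filter_upwards [hev, self_mem_nhdsWithin] with t h1 h2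
    rw [hx t] at h1
    have h3 : 0 < t ^ 2 := by
      have : t ≠ 0 := h2
      positivity
    by_contra hcon
    push Not at hcon
    nlinarith [mul_neg_of_pos_of_neg h3 hcon]
  linarith

theorem hpp_adj {m n : ℕ} (A : Matrix (Fin m) (Fin n) ℝ) (r : Fin m → ℝ) (x : Fin n → ℝ) :
    ∑ i, r i * A.mulVec x i = ∑ j, A.transpose.mulVec r j * x j := by
  simp only [Matrix.mulVec, dotProduct, Finset.mul_sum, Finset.sum_mul, Matrix.transpose_apply]
  rw [Finset.sum_comm]
  exact Finset.sum_congr rfl fun j _ => Finset.sum_congr rfl fun i _ => by ring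

theorem hpp_wt {n : ℕ} (T : Finset (Fin n)) (lam : ℝ) (f : Fin n → ℝ) :
    lam * ∑ j ∈ Tᶜ, f j = ∑ j, (if j ∈ T then 0 else lam) * f j := by
  rw [Finset.mul_sum, ← Finset.sum_subset (Finset.subset_univ Tᶜ)]
  · refine Finset.sum_congr rfl fun j hj => ?_
    rw [if_neg (by simpa using hj)]
  · intro j _ hj
    rw [if_pos (by simpa using hj), zero_mul]

theorem hpp_scalar {z mu u v : ℝ} (hmu : 0 ≤ mu) (h1 : z * v + mu * u = 0)
    (h2 : z * u + mu * v = 0) (h : u ≠ 0 ∨ v ≠ 0) (a b : ℝ) :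
    0 ≤ 2 * (z * (a * b)) + mu * (a ^ 2 + b ^ 2) := by
  have hz : (z - mu) * (z + mu) = 0 := by
    rcases h with h | h
    · apply mul_right_cancel₀ h; linear_combination z * h2 - mu * h1
    · apply mul_right_cancel₀ h; linear_combination z * h1 - mu * h2
  rcases mul_eq_zero.1 hz with h | h
  · obtain rfl : z = mu := by linarith
    nlinarith [mul_nonneg hmu (sq_nonneg (a + b))]
  · obtain rfl : z = -mu := by linarith
    nlinarith [mul_nonneg hmu (sq_nonneg (a - b))]

theorem hpp_main {m n : ℕ} (A : Matrix (Fin m) (Fin n) ℝ) (y : Fin m → ℝ)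
    (T : Finset (Fin n)) (lam : ℝ) (hlam : 0 < lam) (w : (Fin n → ℝ) × (Fin n → ℝ))
    (hG : ∀ d, hppG A y T lam w d = 0) (hH : ∀ d, 0 ≤ hppH A y T lam w d) (p) :
    hppObj A y T lam w ≤ hppObj A y T lam p := by
  set r : Fin m → ℝ := fun i => A.mulVec (fun j => w.1 j * w.2 j) i - y i with hr
  set z := A.transpose.mulVec r with hz
  set mu : Fin n → ℝ := fun j => if j ∈ T then 0 else lam with hmu
  have hmu0 : ∀ j, 0 ≤ mu j := fun j => by simp only [hmu]; split_ifs <;> linarith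
  have hG' : ∀ d : (Fin n → ℝ) × (Fin n → ℝ), (∑ j, z j * (w.1 j * d.2 j + w.2 j * d.1 j)) +
      ∑ j, mu j * (w.1 j * d.1 j + w.2 j * d.2 j) = 0 := by
    intro d
    rw [← hG d, hppG, hpp_wt, hz, ← hpp_adj]
  have f1 : ∀ j, z j * w.2 j + mu j * w.1 j = 0 := fun j => by
    simpa [Pi.single_apply] using hG' (Pi.single j 1, 0)
  have f2 : ∀ j, z j * w.1 j + mu j * w.2 j = 0 := fun j => by
    simpa [Pi.single_apply] using hG' (0, Pi.single j 1)
  have key : ∀ j a b, 0 ≤ 2 * (z j * (a * b)) + mu j * (a ^ 2 + b ^ 2) := by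
    intro j a b
    by_cases h : w.1 j ≠ 0 ∨ w.2 j ≠ 0
    · exact hpp_scalar (hmu0 j) (f1 j) (f2 j) h a b
    · push Not at h
      have hh := hH (Pi.single j a, Pi.single j b)
      have hc : (fun k => w.1 k * (Pi.single j b : Fin n → ℝ) k
          + w.2 k * (Pi.single j a : Fin n → ℝ) k) = 0 := by
        funext k
        by_cases hk : k = j
        · subst hk; simp [h.1, h.2]
        · simp [hk]
      have he : ∑ i, 2 * (r i * A.mulVec (fun k => (Pi.single j a : Fin n → ℝ) k *
          (Pi.single j b : Fin n → ℝ) k) i) = 2 * (z j * (a * b)) := by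
        rw [← Finset.mul_sum, hpp_adj, ← hz, Finset.sum_eq_single j]
        · simp
        · intro k _ hk; simp [hk]
        · simp
      have hm : ∑ k, mu k * ((Pi.single j a : Fin n → ℝ) k ^ 2 +
          (Pi.single j b : Fin n → ℝ) k ^ 2) = mu j * (a ^ 2 + b ^ 2) := by
        rw [Finset.sum_eq_single j]
        · simp
        · intro k _ hk; simp [hk]
        · simp
      rw [← he, ← hm]
      rw [hppH, hpp_wt] at hh
      simp only [hc, Matrix.mulVec_zero, Pi.zero_apply, ne_eq, OfNat.ofNat_ne_zero,
        not_false_eq_true, zero_pow, zero_add] at hh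
      exact hh
  have obj : ∀ q : (Fin n → ℝ) × (Fin n → ℝ), hppObj A y T lam q =
      (∑ i, (A.mulVec (fun j => q.1 j * q.2 j) i - y i) ^ 2) / 2
        + (∑ j, mu j * (q.1 j ^ 2 + q.2 j ^ 2)) / 2 := by
    intro q
    rw [← hpp_wt, hppObj, Finset.sum_add_distrib]; ring
  have a1 := hpp_adj A r (fun j => p.1 j * p.2 j)
  have a2 := hpp_adj A r (fun j => w.1 j * w.2 j)
  rw [← hz] at a1 a2
  have k1 : 0 ≤ 2 * ∑ j, z j * (p.1 j * p.2 j) + ∑ j, mu j * (p.1 j ^ 2 + p.2 j ^ 2) := by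
    rw [Finset.mul_sum, ← Finset.sum_add_distrib]
    exact Finset.sum_nonneg fun j _ => key j _ _
  have k2 : 2 * ∑ j, z j * (w.1 j * w.2 j) + ∑ j, mu j * (w.1 j ^ 2 + w.2 j ^ 2) = 0 := by
    rw [Finset.mul_sum, ← Finset.sum_add_distrib]
    exact Finset.sum_eq_zero fun j _ => by linear_combination w.1 j * f1 j + w.2 j * f2 j
  have k3 : (∑ i, (A.mulVec (fun j => w.1 j * w.2 j) i - y i) ^ 2) +
      2 * (∑ i, r i * A.mulVec (fun j => p.1 j * p.2 j) i) -
      2 * (∑ i, r i * A.mulVec (fun j => w.1 j * w.2 j) i) ≤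
      ∑ i, (A.mulVec (fun j => p.1 j * p.2 j) i - y i) ^ 2 := by
    rw [Finset.mul_sum, Finset.mul_sum, ← Finset.sum_add_distrib, ← Finset.sum_sub_distrib]
    refine Finset.sum_le_sum fun i _ => ?_
    simp only [hr]
    nlinarith [sq_nonneg (A.mulVec (fun j => p.1 j * p.2 j) i - A.mulVec (fun j => w.1 j * w.2 j) i)]
  rw [obj, obj]
  linarith

theorem stmt11 {m n : ℕ} (A : Matrix (Fin m) (Fin n) ℝ) (y : Fin m → ℝ)
    (T : Finset (Fin n)) (lam : ℝ) (hlam : 0 < lam) :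
    -- first-order + second-order stationarity implies global optimality
    (∀ w : (Fin n → ℝ) × (Fin n → ℝ),
      fderiv ℝ (hppObj A y T lam) w = 0 →
      (∀ d : (Fin n → ℝ) × (Fin n → ℝ), 0 ≤ hppHess A y T lam w d d) →
      ∀ p, hppObj A y T lam w ≤ hppObj A y T lam p) ∧
    -- no spurious local minima
    (∀ w : (Fin n → ℝ) × (Fin n → ℝ),
      IsLocalMin (hppObj A y T lam) w → ∀ p, hppObj A y T lam w ≤ hppObj A y T lam p) ∧
    -- every saddle point (critical point that is not a local minimizer) has a
    -- direction of strictly negative curvature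
    (∀ w : (Fin n → ℝ) × (Fin n → ℝ),
      fderiv ℝ (hppObj A y T lam) w = 0 → ¬ IsLocalMin (hppObj A y T lam) w →
      ∃ d : (Fin n → ℝ) × (Fin n → ℝ), hppHess A y T lam w d d < 0) := by
  have h1 : ∀ w : (Fin n → ℝ) × (Fin n → ℝ),
      fderiv ℝ (hppObj A y T lam) w = 0 →
      (∀ d : (Fin n → ℝ) × (Fin n → ℝ), 0 ≤ hppHess A y T lam w d d) →
      ∀ p, hppObj A y T lam w ≤ hppObj A y T lam p := by
    intro w hw hd
    refine hpp_main A y T lam hlam w (fun d => ?_) (fun d => ?_)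
    · rw [← hpp_fderiv, hw]; rfl
    · rw [← hppHess_eq]; exact hd d
  refine ⟨h1, fun w hw => h1 w hw.fderiv_eq_zero fun d => ?_, fun w hw hn => ?_⟩
  · rw [hppHess_eq]; exact hpp_local A y T lam w d hw
  · by_contra hcon
    push Not at hcon
    exact hn (Filter.Eventually.of_forall (h1 w hw hcon))
end

section
/- Let A ∈ ℝ^{m×n}, y ∈ ℝ^m, T ⊆ {1,…,n}, λ > 0, and suppose (û, v̂) ∈ ℝⁿ×ℝⁿ satisfies ∇g(û, v̂) = 0 and ∇²g(û, v̂) ⪰ 0. Set γ = Aᵀ(A(û∘v̂) − y) ∈ ℝⁿ. Then for every j ∈ T^c: |û_j| = |v̂_j|, and if û_j v̂_j ≠ 0 then γ_j = −λ·sign(û_j v̂_j); moreover, for every j ∈ T with û_j ≠ 0 or v̂_j ≠ 0, γ_j = 0. -/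
open scoped BigOperators
open Matrix

lemma hpp_dir {m n : ℕ} (A : Matrix (Fin m) (Fin n) ℝ) (y : Fin m → ℝ)
    (T : Finset (Fin n)) (lam : ℝ) (u v a b : Fin n → ℝ)
    (hcrit : fderiv ℝ (hppObj A y T lam) (u, v) = 0) :
    (∑ i, (A.mulVec (fun j => u j * v j) i - y i) * ∑ j, A i j * (a j * v j + u j * b j))
      + lam * ((∑ j ∈ Tᶜ, u j * a j) + ∑ j ∈ Tᶜ, v j * b j) = 0 := by
  have hd : Differentiable ℝ (hppObj A y T lam) := by
    unfold hppObj
    simp only [Matrix.mulVec, dotProduct]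
    fun_prop
  have h1 : HasFDerivAt (hppObj A y T lam)
      (0 : ((Fin n → ℝ) × (Fin n → ℝ)) →L[ℝ] ℝ) (u, v) := by
    rw [← hcrit]; exact (hd _).hasFDerivAt
  have ha : ∀ j, HasDerivAt (fun t : ℝ => u j + t * a j) (a j) 0 := fun j => by
    simpa using ((hasDerivAt_id (0 : ℝ)).mul_const (a j)).const_add (u j)
  have hb : ∀ j, HasDerivAt (fun t : ℝ => v j + t * b j) (b j) 0 := fun j => by
    simpa using ((hasDerivAt_id (0 : ℝ)).mul_const (b j)).const_add (v j)
  let c : ℝ → (Fin n → ℝ) × (Fin n → ℝ) :=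
    fun t => (fun j => u j + t * a j, fun j => v j + t * b j)
  have hc : HasDerivAt c (a, b) 0 :=
    (hasDerivAt_pi.2 ha).prodMk (hasDerivAt_pi.2 hb)
  have hc0 : c 0 = (u, v) := by simp [c]
  rw [← hc0] at h1
  have h2 := h1.comp_hasDerivAt (0 : ℝ) hc
  have h3 : HasDerivAt (hppObj A y T lam ∘ c) _ 0 :=
    ((HasDerivAt.fun_sum (u := Finset.univ) fun i _ =>
      (((HasDerivAt.fun_sum (u := Finset.univ) fun j _ =>
        (((ha j).mul (hb j)).const_mul (A i j))).sub_const (y i)).pow 2)).div_const 2).add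
      (((HasDerivAt.fun_sum (u := Tᶜ) fun j _ => (ha j).pow 2).add
        (HasDerivAt.fun_sum (u := Tᶜ) fun j _ => (hb j).pow 2)).const_mul (lam / 2))
  have h4 := h3.unique h2
  simp only [ContinuousLinearMap.zero_apply] at h4
  rw [← h4]
  simp [Matrix.mulVec, dotProduct, Finset.sum_div, Finset.mul_sum, mul_add]
  congr 1
  · refine Finset.sum_congr rfl fun i _ => ?_
    first | exact Finset.sum_congr rfl (fun i _ => by ring) | (rw [Finset.sum_div]; exact Finset.sum_congr rfl (fun i _ => by ring))
  · congr 1 <;> exact Finset.sum_congr rfl fun i _ => by ring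

theorem stmt12 {m n : ℕ} (A : Matrix (Fin m) (Fin n) ℝ) (y : Fin m → ℝ)
    (T : Finset (Fin n)) (lam : ℝ) (hlam : 0 < lam)
    (uhat vhat : Fin n → ℝ)
    (hcrit : fderiv ℝ (hppObj A y T lam) (uhat, vhat) = 0)
    (hpsd : ∀ d : (Fin n → ℝ) × (Fin n → ℝ), 0 ≤ hppHess A y T lam (uhat, vhat) d d)
    (γ : Fin n → ℝ)
    (hγ : γ = Aᵀ.mulVec (A.mulVec (fun j => uhat j * vhat j) - y)) :
    (∀ j ∈ Tᶜ, |uhat j| = |vhat j| ∧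
        (uhat j * vhat j ≠ 0 → γ j = -lam * Real.sign (uhat j * vhat j))) ∧
      ∀ j ∈ T, (uhat j ≠ 0 ∨ vhat j ≠ 0) → γ j = 0 := by
  have hg : ∀ j, γ j = ∑ i, (A.mulVec (fun j => uhat j * vhat j) i - y i) * A i j := by
    intro j
    rw [hγ]
    simp [Matrix.mulVec, dotProduct, Matrix.transpose_apply, mul_comm]
  have e1 : ∀ j, γ j * vhat j + lam * (if j ∈ Tᶜ then uhat j else 0) = 0 := by
    intro j
    have h := hpp_dir A y T lam uhat vhat (Pi.single j 1) 0 hcrit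
    simp [Pi.single_apply] at h
    rw [hg, Finset.sum_mul]
    simp only [mul_assoc]
    simpa using h
  have e2 : ∀ j, γ j * uhat j + lam * (if j ∈ Tᶜ then vhat j else 0) = 0 := by
    intro j
    have h := hpp_dir A y T lam uhat vhat 0 (Pi.single j 1) hcrit
    simp [Pi.single_apply] at h
    rw [hg, Finset.sum_mul]
    simp only [mul_assoc]
    simpa using h
  refine ⟨fun j hj => ?_, fun j hj h => ?_⟩
  · have h1 := e1 j
    have h2 := e2 j
    rw [if_pos hj] at h1 h2
    have hsq : uhat j ^ 2 = vhat j ^ 2 := by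
      have : lam * (uhat j ^ 2 - vhat j ^ 2) = 0 := by linear_combination uhat j * h1 - vhat j * h2
      rcases mul_eq_zero.1 this with h | h
      · exact absurd h hlam.ne'
      · linarith
    refine ⟨(sq_eq_sq_iff_abs_eq_abs _ _).1 hsq, fun hne => ?_⟩
    have hv : vhat j ≠ 0 := right_ne_zero_of_mul hne
    have hu : uhat j ≠ 0 := left_ne_zero_of_mul hne
    rcases sq_eq_sq_iff_eq_or_eq_neg.1 hsq with h | h
    · rw [Real.sign_of_pos (by rw [h]; exact mul_self_pos.2 hv)]
      apply mul_right_cancel₀ hv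
      rw [h] at h1
      linarith
    · rw [Real.sign_of_neg (by rw [h]; have : 0 < vhat j * vhat j := mul_self_pos.2 hv
                               linarith)]
      apply mul_right_cancel₀ hv
      rw [h] at h1
      linarith
  · have h1 := e1 j
    have h2 := e2 j
    simp [hj] at h1 h2
    tauto
end

section
/- Let A ∈ ℝ^{m×n} with rank(A) = m, y ∈ ℝ^m, T ⊆ {1,…,n} with |T| ≤ m, and λ > 0. For any initial point (u₀, v₀) ∈ ℝⁿ×ℝⁿ and any step parameter α > 0, the sequence (u_k, v_k) generated by proximal alternating minimization applied to g converges to a point (u*, v*) satisfying ∇g(u*, v*) = 0 (a critical point of g). -/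
open scoped BigOperators
open Matrix

theorem seq_lemma (D t M : ℕ → ℝ) (K : ℝ) (hK : 0 ≤ K) (hD : ∀ k, 0 ≤ D k) (ht : ∀ k, 0 ≤ t k)
    (hM : ∀ k, 0 ≤ M k)
    (h1 : ∀ k, D k ^ 2 ≤ t k ^ 4 - t (k+1) ^ 4)
    (h2 : ∀ k, M (k+1) ≤ M k + K * D k) (h3 : ∀ k, M k ≤ M (k+1) + K * D k)
    (h4 : ∀ k, t (k+1) ^ 3 ≤ K * (M k * D k)) : Summable D := by
  have hanti : ∀ k, t (k+1) ≤ t k := by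
    intro k
    have : t (k+1) ^ 4 ≤ t k ^ 4 := by nlinarith [h1 k, sq_nonneg (D k)]
    exact le_of_pow_le_pow_left₀ (by norm_num) (ht k) this
  have hstep : ∀ k, D (k+1) ≤ D k / 2 + 2 * K * M k * (t (k+1) - t (k+2)) := by
    intro k
    have hd : 0 ≤ t (k+1) - t (k+2) := sub_nonneg.2 (hanti (k+1))
    have a1 : t (k+1) ^ 4 - t (k+2) ^ 4 ≤ 4 * t (k+1) ^ 3 * (t (k+1) - t (k+2)) := by
      have e : 4 * t (k+1) ^ 3 * (t (k+1) - t (k+2)) - (t (k+1) ^ 4 - t (k+2) ^ 4)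
        = (t (k+1) - t (k+2)) ^ 2 * (3 * t (k+1) ^ 2 + 2 * t (k+1) * t (k+2) + t (k+2) ^ 2) := by
        ring
      have := ht (k+1); have := ht (k+2)
      have : 0 ≤ (t (k+1) - t (k+2)) ^ 2 *
        (3 * t (k+1) ^ 2 + 2 * t (k+1) * t (k+2) + t (k+2) ^ 2) := by positivity
      linarith
    have a2 : 4 * t (k+1) ^ 3 * (t (k+1) - t (k+2))
        ≤ 4 * (K * (M k * D k)) * (t (k+1) - t (k+2)) := by
      have := h4 k
      gcongr
    have hR : 0 ≤ 2 * K * M k * (t (k+1) - t (k+2)) := by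
      have := hM k
      positivity
    have := hD k
    refine le_of_sq_le_sq ?_ (by positivity)
    have a0 := h1 (k+1)
    have : (k + 1 + 1) = k + 2 := rfl
    rw [this] at a0
    nlinarith [sq_nonneg (D k / 2 - 2 * K * M k * (t (k+1) - t (k+2)))]
  have hW0 : ∀ k, 0 ≤ M (k+1) + K * D k := fun k => by
    have := hM (k+1); have := hD k; positivity
  have hW : ∀ k, M (k+1) + K * D k ≤
      (M 1 + K * D 0) * Real.exp (4 * K ^ 2 * (t 1 - t (k+1))) := by
    intro k
    induction k with
    | zero => simp
    | succ k ih =>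
      have hd : 0 ≤ t (k+1) - t (k+2) := sub_nonneg.2 (hanti (k+1))
      have b1 : M (k+1+1) + K * D (k+1) ≤
          (M (k+1) + K * D k) * (1 + 4 * K^2 * (t (k+1) - t (k+2))) := by
        have c1 := h2 (k+1)
        have c2 := mul_le_mul_of_nonneg_left (hstep k) (by positivity : 0 ≤ 2 * K)
        have c3 : 4 * K^2 * (t (k+1) - t (k+2)) * M k ≤
          4 * K^2 * (t (k+1) - t (k+2)) * (M (k+1) + K * D k) :=
          mul_le_mul_of_nonneg_left (h3 k) (by positivity)
        nlinarith
      have b2 : 1 + 4 * K^2 * (t (k+1) - t (k+2)) ≤ Real.exp (4 * K^2 * (t (k+1) - t (k+2))) := by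
        have := Real.add_one_le_exp (4 * K^2 * (t (k+1) - t (k+2)))
        linarith
      calc _ ≤ _ := b1
        _ ≤ (M (k+1) + K * D k) * Real.exp (4 * K^2 * (t (k+1) - t (k+2))) :=
          mul_le_mul_of_nonneg_left b2 (hW0 k)
        _ ≤ ((M 1 + K * D 0) * Real.exp (4 * K ^ 2 * (t 1 - t (k+1)))) *
            Real.exp (4 * K^2 * (t (k+1) - t (k+2))) :=
          mul_le_mul_of_nonneg_right ih (Real.exp_pos _).le
        _ = _ := by
          rw [mul_assoc, ← Real.exp_add]
          congr 2
          ring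
  obtain ⟨Wb, hWb0, hWb⟩ : ∃ Wb : ℝ, 0 ≤ Wb ∧ ∀ k, M k ≤ Wb := by
    refine ⟨(M 1 + K * D 0) * Real.exp (4 * K ^ 2 * t 1),
      mul_nonneg (hW0 0) (Real.exp_pos _).le, fun k => (h3 k).trans ((hW k).trans ?_)⟩
    refine mul_le_mul_of_nonneg_left (Real.exp_le_exp.2 ?_) (hW0 0)
    exact mul_le_mul_of_nonneg_left (by linarith [ht (k+1)]) (by positivity)
  have hS : ∀ N, (∑ i ∈ Finset.range N, D i) + 2 * D N + 4 * K * Wb * t (N+1)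
      ≤ 2 * D 0 + 4 * K * Wb * t 1 := by
    intro N
    induction N with
    | zero => simp
    | succ N ih =>
      rw [Finset.sum_range_succ]
      have hd : 0 ≤ t (N+1) - t (N+2) := sub_nonneg.2 (hanti (N+1))
      have c3 : 2 * K * M N * (t (N+1) - t (N+2)) ≤ 2 * K * Wb * (t (N+1) - t (N+2)) := by
        have := hWb N
        gcongr
      have c4 := hstep N
      have : N + 1 + 1 = N + 2 := rfl
      rw [this]
      nlinarith
  refine summable_of_sum_range_le hD (c := 2 * D 0 + 4 * K * Wb * t 1) fun N => ?_
  have := hS N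
  have := hD N
  have : 0 ≤ 4 * K * Wb * t (N+1) := by have := ht (N+1); positivity
  linarith

noncomputable def qF {m : ℕ} {ι : Type} [Fintype ι] (B : Matrix (Fin m) ι ℝ) (y : Fin m → ℝ)
    (l : ι → ℝ) (a : ι → ℝ) : ℝ := (∑ i, ((B *ᵥ a) i - y i) ^ 2) / 2 + l ⬝ᵥ a

noncomputable def qG {m : ℕ} {ι : Type} [Fintype ι] (B : Matrix (Fin m) ι ℝ) (y : Fin m → ℝ)
    (l : ι → ℝ) (a : ι → ℝ) : ι → ℝ := Bᵀ *ᵥ (B *ᵥ a - y) + l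

theorem qF_add {m : ℕ} {ι : Type} [Fintype ι] (B : Matrix (Fin m) ι ℝ) (y : Fin m → ℝ)
    (l a d : ι → ℝ) : qF B y l (a + d) = qF B y l a + qG B y l a ⬝ᵥ d
      + (B *ᵥ d) ⬝ᵥ (B *ᵥ d) / 2 := by
  have h : (Bᵀ *ᵥ (B *ᵥ a - y)) ⬝ᵥ d = (B *ᵥ a - y) ⬝ᵥ (B *ᵥ d) := by
    rw [Matrix.mulVec_transpose, Matrix.dotProduct_mulVec]
  unfold qF qG
  rw [add_dotProduct, h, Matrix.mulVec_add, dotProduct_add]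
  simp only [dotProduct, Pi.add_apply, Pi.sub_apply, Finset.sum_div]
  have : ∀ i, ((B *ᵥ a) i + (B *ᵥ d) i - y i) ^ 2 / 2 = ((B *ᵥ a) i - y i) ^ 2 / 2 +
    ((B *ᵥ a) i - y i) * (B *ᵥ d) i + (B *ᵥ d) i * (B *ᵥ d) i / 2 := fun i => by ring
  simp only [this, Finset.sum_add_distrib]
  ring

theorem qG_add {m : ℕ} {ι : Type} [Fintype ι] (B : Matrix (Fin m) ι ℝ) (y : Fin m → ℝ)
    (l a d : ι → ℝ) : qG B y l (a + d) = qG B y l a + (Bᵀ * B) *ᵥ d := by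
  unfold qG
  rw [← Matrix.mulVec_mulVec, Matrix.mulVec_add, add_sub_right_comm, Matrix.mulVec_add]
  abel

theorem dot_le {ι : Type} [Fintype ι] (a b : ι → ℝ) :
    |a ⬝ᵥ b| ≤ Fintype.card ι * (‖a‖ * ‖b‖) := by
  unfold dotProduct
  refine (Finset.abs_sum_le_sum_abs _ _).trans ?_
  have : ∀ i ∈ (Finset.univ : Finset ι), |a i * b i| ≤ ‖a‖ * ‖b‖ := fun i _ => by
    rw [abs_mul]
    exact mul_le_mul (norm_le_pi_norm a i) (norm_le_pi_norm b i) (abs_nonneg _) (norm_nonneg _)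
  refine (Finset.sum_le_sum this).trans ?_
  simp

theorem mulVec_bd {κ : Type} [Fintype κ] {ι : Type} [Fintype ι] (H : Matrix κ ι ℝ) :
    ∃ K : ℝ, 0 ≤ K ∧ ∀ d, ‖H *ᵥ d‖ ≤ K * ‖d‖ := by
  classical
  refine ⟨‖LinearMap.toContinuousLinearMap (Matrix.toLin' H)‖, norm_nonneg _, fun d => ?_⟩
  have := (LinearMap.toContinuousLinearMap (Matrix.toLin' H)).le_opNorm d
  simpa using this

theorem rinv_bd {ι : Type} [Fintype ι] (H : Matrix ι ι ℝ) :
    ∃ K : ℝ, 0 ≤ K ∧ ∀ z : ι → ℝ, ∃ z' : ι → ℝ, H *ᵥ z' = H *ᵥ z ∧ ‖z'‖ ≤ K * ‖H *ᵥ z‖ := by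
  classical
  obtain ⟨g, hg⟩ := LinearMap.exists_rightInverse_of_surjective (Matrix.toLin' H).rangeRestrict
    (LinearMap.range_rangeRestrict _)
  refine ⟨‖LinearMap.toContinuousLinearMap g‖, ContinuousLinearMap.opNorm_nonneg _, fun z => ?_⟩
  refine ⟨g ((Matrix.toLin' H).rangeRestrict z), ?_, ?_⟩
  · have := congrArg (fun f => ((f ((Matrix.toLin' H).rangeRestrict z) :
      LinearMap.range (Matrix.toLin' H)) : ι → ℝ)) hg
    simpa using this
  · have := (LinearMap.toContinuousLinearMap g).le_opNorm ((Matrix.toLin' H).rangeRestrict z)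
    simpa using this

theorem pl_lemma {m : ℕ} {ι : Type} [Fintype ι] (B : Matrix (Fin m) ι ℝ) (y : Fin m → ℝ)
    (l : ι → ℝ) : (∃ c : ℝ, 0 < c ∧ ∀ a, c ≤ ‖qG B y l a‖) ∨
      ∃ v C : ℝ, 0 ≤ C ∧ ∀ a, v ≤ qF B y l a ∧ qF B y l a ≤ v + C * ‖qG B y l a‖ ^ 2 := by
  classical
  by_cases h : ∃ a0, qG B y l a0 = 0
  · right
    obtain ⟨a0, h0⟩ := h
    obtain ⟨K, hK, hr⟩ := rinv_bd (Bᵀ * B)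
    refine ⟨qF B y l a0, Fintype.card ι * K, by positivity, fun a => ?_⟩
    have ha : a = a0 + (a - a0) := by abel
    have e1 : qF B y l a = qF B y l a0 + (B *ᵥ (a - a0)) ⬝ᵥ (B *ᵥ (a - a0)) / 2 := by
      conv_lhs => rw [ha]
      rw [qF_add, h0]; simp
    have e2 : qG B y l a = (Bᵀ * B) *ᵥ (a - a0) := by
      conv_lhs => rw [ha]
      rw [qG_add, h0]; simp
    have hq : ∀ z w : ι → ℝ, (B *ᵥ z) ⬝ᵥ (B *ᵥ w) = ((Bᵀ * B) *ᵥ z) ⬝ᵥ w := by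
      intro z w
      rw [← Matrix.mulVec_mulVec, Matrix.mulVec_transpose, Matrix.dotProduct_mulVec]
    have hnn : 0 ≤ (B *ᵥ (a - a0)) ⬝ᵥ (B *ᵥ (a - a0)) :=
      Finset.sum_nonneg fun i _ => mul_self_nonneg _
    refine ⟨by rw [e1]; linarith, ?_⟩
    obtain ⟨z', hz1, hz2⟩ := hr (a - a0)
    have e3 : (B *ᵥ (a - a0)) ⬝ᵥ (B *ᵥ (a - a0)) = ((Bᵀ * B) *ᵥ (a - a0)) ⬝ᵥ z' := by
      rw [hq, ← hz1, ← hq, dotProduct_comm, hq, ← hz1]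
    have e4 := (le_abs_self _).trans (dot_le ((Bᵀ * B) *ᵥ (a - a0)) z')
    rw [← e3, ← e2] at e4
    rw [← e2] at hz2
    rw [e1]
    have : (Fintype.card ι : ℝ) * (‖qG B y l a‖ * ‖z'‖) ≤
      (Fintype.card ι : ℝ) * (‖qG B y l a‖ * (K * ‖qG B y l a‖)) := by gcongr
    nlinarith
  · left
    push Not at h
    have hcl : IsClosed (LinearMap.range (Matrix.toLin' (Bᵀ * B)) : Set (ι → ℝ)) :=
      Submodule.closed_of_finiteDimensional _
    have hq : ∀ a, qG B y l a = qG B y l 0 + (Bᵀ * B) *ᵥ a := fun a => by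
      rw [← qG_add, zero_add]
    have hn : - qG B y l 0 ∉ (LinearMap.range (Matrix.toLin' (Bᵀ * B)) : Set (ι → ℝ)) := by
      rintro ⟨a, ha⟩
      apply h a
      rw [hq]
      rw [Matrix.toLin'_apply] at ha
      rw [ha]; simp
    obtain ⟨c, hc, hb⟩ := Metric.isOpen_iff.1 hcl.isOpen_compl _ hn
    refine ⟨c, hc, fun a => ?_⟩
    by_contra hlt
    push Not at hlt
    have : (Bᵀ * B) *ᵥ a ∈ Metric.ball (- qG B y l 0) c := by
      rw [Metric.mem_ball, dist_eq_norm, sub_neg_eq_add, add_comm, ← hq]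
      exact hlt
    exact hb this ⟨a, by simp⟩

/-- zero out coordinates outside `J` -/
noncomputable def cut {ι : Type} [DecidableEq ι] (J : Finset ι) (a : ι → ℝ) : ι → ℝ :=
  fun i => if i ∈ J then a i else 0

noncomputable def cutM {m : ℕ} {ι : Type} [DecidableEq ι] (J : Finset ι)
    (B : Matrix (Fin m) ι ℝ) : Matrix (Fin m) ι ℝ :=
  fun r i => if i ∈ J then B r i else 0

theorem cutM_mulVec {m : ℕ} {ι : Type} [Fintype ι] [DecidableEq ι] (J : Finset ι)
    (B : Matrix (Fin m) ι ℝ) (a : ι → ℝ) : cutM J B *ᵥ a = B *ᵥ cut J a := by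
  ext r
  simp [Matrix.mulVec, dotProduct, cutM, cut]

theorem qF_cut {m : ℕ} {ι : Type} [Fintype ι] [DecidableEq ι] (J : Finset ι)
    (B : Matrix (Fin m) ι ℝ) (y : Fin m → ℝ) (l a : ι → ℝ) :
    qF (cutM J B) y (cut J l) a = qF B y l (cut J a) := by
  unfold qF
  rw [cutM_mulVec]
  congr 1
  simp [dotProduct, cut]

theorem qG_cut {m : ℕ} {ι : Type} [Fintype ι] [DecidableEq ι] (J : Finset ι)
    (B : Matrix (Fin m) ι ℝ) (y : Fin m → ℝ) (l a : ι → ℝ) :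
    qG (cutM J B) y (cut J l) a = cut J (qG B y l (cut J a)) := by
  unfold qG
  rw [cutM_mulVec]
  ext i
  by_cases h : i ∈ J <;> simp [Matrix.mulVec, dotProduct, cutM, cut, h]

theorem kl_J {m : ℕ} {ι : Type} [Fintype ι] [DecidableEq ι] (J : Finset ι)
    (B : Matrix (Fin m) ι ℝ) (y : Fin m → ℝ) (l : ι → ℝ) (ginf G : ℝ) (hG : 0 ≤ G) :
    ∃ C σ : ℝ, 0 < C ∧ 0 < σ ∧ ∀ (x a : ι → ℝ) (η : ℝ), 0 ≤ η → (∀ i, a i = x i ^ 2) →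
      (∀ i, |x i * qG B y l a i| ≤ η ^ 3) → (∀ i ∈ J, |qG B y l a i| ≤ η ^ 2) →
      (∀ i, i ∉ J → η ^ 2 < |qG B y l a i|) →
      (‖qG B y l a‖ ≤ G) → qF B y l a ≤ ginf + σ → qF B y l a - ginf ≤ C * η ^ 4 := by
  obtain ⟨K, hK, hKb⟩ := mulVec_bd (Bᵀ * B)
  set N : ℝ := (Fintype.card ι : ℝ) with hN
  have hN0 : 0 ≤ N := by positivity
  -- common facts
  have key : ∀ (x a : ι → ℝ) (η : ℝ), 0 ≤ η → (∀ i, a i = x i ^ 2) →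
      (∀ i, |x i * qG B y l a i| ≤ η ^ 3) → (∀ i ∈ J, |qG B y l a i| ≤ η ^ 2) →
      (∀ i, i ∉ J → η ^ 2 < |qG B y l a i|) → (‖qG B y l a‖ ≤ G) →
      ‖cut J (qG B y l (cut J a))‖ ≤ (1 + K) * η ^ 2 ∧
      qF B y l a ≤ qF B y l (cut J a) + N * η ^ 4 ∧
      qF B y l (cut J a) ≤ qF B y l a + N * G * η ^ 2 + N * K * η ^ 4 := by
    intro x a η hη ha h1 h2 h3 hGb
    set d : ι → ℝ := cut J a - a with hd
    have had : cut J a = a + d := by rw [hd]; abel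
    have hx : ∀ i, i ∉ J → |x i| ≤ η := by
      intro i hi
      have e1 := h1 i
      have e2 := h3 i hi
      rw [abs_mul] at e1
      rcases hη.eq_or_lt with h0 | h0
      · subst h0
        have : 0 < |qG B y l a i| := by simpa using e2
        have e3 : |x i| * |qG B y l a i| ≤ 0 := by simpa using e1
        nlinarith [abs_nonneg (x i)]
      · have : |x i| * η ^ 2 ≤ η * η ^ 2 := by
          have := mul_le_mul_of_nonneg_left e2.le (abs_nonneg (x i))
          nlinarith
        exact le_of_mul_le_mul_right this (by positivity)
    have hdi : ∀ i, d i = if i ∈ J then 0 else - x i ^ 2 := by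
      intro i
      by_cases h : i ∈ J <;> simp [hd, cut, h, ha]
    have hdn : ‖d‖ ≤ η ^ 2 := by
      refine (pi_norm_le_iff_of_nonneg (by positivity)).2 fun i => ?_
      rw [hdi]
      split_ifs with h
      · simp; positivity
      · rw [norm_neg, norm_pow]
        exact pow_le_pow_left₀ (norm_nonneg _) (hx i h) 2
    refine ⟨?_, ?_, ?_⟩
    · refine (pi_norm_le_iff_of_nonneg (by positivity)).2 fun i => ?_
      by_cases h : i ∈ J
      · simp only [cut, h, if_true]
        change ‖qG B y l (cut J a) i‖ ≤ _
        rw [had, qG_add, Pi.add_apply]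
        refine (norm_add_le _ _).trans ?_
        have e1 := (norm_le_pi_norm ((Bᵀ * B) *ᵥ d) i).trans (hKb d)
        have e2 := mul_le_mul_of_nonneg_left hdn hK
        have e3 := h2 i h
        rw [← Real.norm_eq_abs] at e3
        linarith
      · simp only [cut, h, if_false, norm_zero]
        positivity
    · rw [had, qF_add]
      have e1 : 0 ≤ (B *ᵥ d) ⬝ᵥ (B *ᵥ d) := Finset.sum_nonneg fun i _ => mul_self_nonneg _
      have e2 : -(N * η ^ 4) ≤ qG B y l a ⬝ᵥ d := by
        have : ∀ i ∈ (Finset.univ : Finset ι), -(η ^ 4) ≤ qG B y l a i * d i := by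
          intro i _
          rw [hdi]
          split_ifs with h
          · simp; positivity
          · have f1 : |x i * (x i * qG B y l a i)| ≤ η * η ^ 3 := by
              rw [abs_mul]
              exact mul_le_mul (hx i h) (h1 i) (abs_nonneg _) hη
            have := (abs_le.1 f1).2
            nlinarith
        have := Finset.sum_le_sum this
        simpa [dotProduct, hN] using this
      linarith
    · rw [had, qF_add]
      have e1 : (B *ᵥ d) ⬝ᵥ (B *ᵥ d) = ((Bᵀ * B) *ᵥ d) ⬝ᵥ d := by
        rw [← Matrix.mulVec_mulVec, Matrix.mulVec_transpose, Matrix.dotProduct_mulVec]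
      have e2 := (le_abs_self _).trans (dot_le ((Bᵀ * B) *ᵥ d) d)
      have e3 := (le_abs_self _).trans (dot_le (qG B y l a) d)
      have e4 : N * (‖(Bᵀ * B) *ᵥ d‖ * ‖d‖) ≤ N * ((K * η ^ 2) * η ^ 2) := by
        have : ‖(Bᵀ * B) *ᵥ d‖ ≤ K * η ^ 2 := (hKb d).trans (by gcongr)
        gcongr
      have e5 : N * (‖qG B y l a‖ * ‖d‖) ≤ N * (G * η ^ 2) := by gcongr
      rw [e1]
      have e6 : 0 ≤ N * ((K * η ^ 2) * η ^ 2) := by positivity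
      nlinarith
  have hsm : ∀ c : ℝ, 0 < c → ∀ η σ s : ℝ, 0 < σ → c ≤ η ^ 2 → s ≤ σ →
      s ≤ (σ / c ^ 2) * η ^ 4 := by
    intro c hc η σ s hσ h1 h2
    have : c ^ 2 ≤ (η ^ 2) ^ 2 := pow_le_pow_left₀ hc.le h1 2
    have e : σ = σ / c ^ 2 * c ^ 2 := by field_simp
    calc s ≤ σ := h2
      _ = σ / c ^ 2 * c ^ 2 := e
      _ ≤ σ / c ^ 2 * (η ^ 2) ^ 2 := by gcongr
      _ = _ := by ring
  rcases pl_lemma (cutM J B) y (cut J l) with ⟨c, hc, hcb⟩ | ⟨v, C, hC, hb⟩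
  · refine ⟨1 / (c / (1 + K)) ^ 2, 1, by positivity, one_pos, ?_⟩
    intro x a η hη ha h1 h2 h3 hGb hs
    obtain ⟨k1, k2, k3⟩ := key x a η hη ha h1 h2 h3 hGb
    have := hcb a
    rw [qG_cut] at this
    refine hsm _ (by positivity) η 1 _ one_pos ?_ (by linarith)
    rw [div_le_iff₀ (by positivity)]
    linarith
  · rcases le_or_gt v ginf with hv | hv
    · refine ⟨N + C * (1 + K) ^ 2 + 1, 1, by positivity, one_pos, ?_⟩
      intro x a η hη ha h1 h2 h3 hGb hs
      obtain ⟨k1, k2, k3⟩ := key x a η hη ha h1 h2 h3 hGb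
      have := (hb a).2
      rw [qG_cut, qF_cut] at this
      have e : C * ‖cut J (qG B y l (cut J a))‖ ^ 2 ≤ C * ((1 + K) * η ^ 2) ^ 2 := by gcongr
      have : 0 ≤ η ^ 4 := by positivity
      nlinarith
    · have hσ : 0 < (v - ginf) / 2 := by linarith
      set σ := (v - ginf) / 2 with hσd
      set Q := N * G + N * K + σ with hQ
      have hQ0 : 0 < Q := by positivity
      refine ⟨σ / (σ / Q) ^ 2, σ, by positivity, hσ, ?_⟩
      intro x a η hη ha h1 h2 h3 hGb hs
      obtain ⟨k1, k2, k3⟩ := key x a η hη ha h1 h2 h3 hGb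
      have := (hb a).1
      rw [qF_cut] at this
      refine hsm _ (by positivity) η σ _ hσ ?_ (by linarith)
      rw [div_le_iff₀ hQ0]
      rcases le_or_gt (η ^ 2) 1 with h | h
      · have e1 : η ^ 4 ≤ η ^ 2 := by nlinarith [sq_nonneg η]
        have e2 : N * K * η ^ 4 ≤ N * K * η ^ 2 := by gcongr
        have e3 : 0 ≤ η ^ 2 * σ := by positivity
        have e4 : σ ≤ N * G * η ^ 2 + N * K * η ^ 2 := by linarith
        rw [hQ]; nlinarith
      · have : σ ≤ Q := by
          have : 0 ≤ N * G + N * K := by positivity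
          linarith
        nlinarith

theorem kl_main {m : ℕ} {ι : Type} [Fintype ι] [DecidableEq ι]
    (B : Matrix (Fin m) ι ℝ) (y : Fin m → ℝ) (l : ι → ℝ) (ginf G : ℝ) (hG : 0 ≤ G) :
    ∃ C σ : ℝ, 1 ≤ C ∧ 0 < σ ∧ ∀ (x a : ι → ℝ) (η : ℝ), 0 ≤ η → (∀ i, a i = x i ^ 2) →
      (∀ i, |x i * qG B y l a i| ≤ η ^ 3) →
      (‖qG B y l a‖ ≤ G) → qF B y l a ≤ ginf + σ → qF B y l a - ginf ≤ C * η ^ 4 := by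
  choose C σ hC hσ h using fun J : Finset ι => kl_J J B y l ginf G hG
  obtain ⟨J0, hJ0⟩ := Finite.exists_min σ
  refine ⟨1 + ∑ J, C J, σ J0, ?_, hσ J0, ?_⟩
  · have : 0 ≤ ∑ J, C J := Finset.sum_nonneg fun J _ => (hC J).le
    linarith
  · intro x a η hη ha h1 hGb hs
    let J : Finset ι := Finset.univ.filter fun i => |qG B y l a i| ≤ η ^ 2
    have := h J x a η hη ha h1 (fun i hi => by simpa [J] using hi)
      (fun i hi => by simpa [J] using hi) hGb (hs.trans (by linarith [hJ0 J]))
    refine this.trans ?_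
    have hle : C J ≤ 1 + ∑ J, C J := by
      have := Finset.single_le_sum (f := C) (fun J _ => (hC J).le) (Finset.mem_univ J)
      linarith
    gcongr

noncomputable def lw {n : ℕ} (T : Finset (Fin n)) (lam : ℝ) (j : Fin n) : ℝ :=
  if j ∈ T then 0 else lam

noncomputable def cc {m n : ℕ} (A : Matrix (Fin m) (Fin n) ℝ) (y : Fin m → ℝ)
    (u v : Fin n → ℝ) : Fin n → ℝ := Aᵀ *ᵥ (A *ᵥ (u * v) - y)

theorem hpp_eq {m n : ℕ} (A : Matrix (Fin m) (Fin n) ℝ) (y : Fin m → ℝ)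
    (T : Finset (Fin n)) (lam : ℝ) (u v : Fin n → ℝ) :
    hppObj A y T lam (u, v) = (∑ i, ((A *ᵥ (u * v)) i - y i) ^ 2) / 2
      + ∑ j, lw T lam j / 2 * (u j ^ 2 + v j ^ 2) := by
  unfold hppObj
  congr 1
  rw [← Finset.sum_add_distrib, Finset.mul_sum, ← Finset.sum_subset (Finset.subset_univ Tᶜ)]
  · refine Finset.sum_congr rfl fun j hj => ?_
    rw [Finset.mem_compl] at hj
    simp [lw, hj]
  · intro j _ hj
    rw [Finset.mem_compl, not_not] at hj
    simp [lw, hj]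

theorem hpp_symm {m n : ℕ} (A : Matrix (Fin m) (Fin n) ℝ) (y : Fin m → ℝ)
    (T : Finset (Fin n)) (lam : ℝ) (u v : Fin n → ℝ) :
    hppObj A y T lam (u, v) = hppObj A y T lam (v, u) := by
  rw [hpp_eq, hpp_eq, mul_comm u v]
  simp only [add_comm]

theorem cc_symm {m n : ℕ} (A : Matrix (Fin m) (Fin n) ℝ) (y : Fin m → ℝ)
    (u v : Fin n → ℝ) : cc A y u v = cc A y v u := by
  unfold cc; rw [mul_comm]

theorem hpp_add {m n : ℕ} (A : Matrix (Fin m) (Fin n) ℝ) (y : Fin m → ℝ)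
    (T : Finset (Fin n)) (lam : ℝ) (u v d : Fin n → ℝ) :
    hppObj A y T lam (u, v + d) = hppObj A y T lam (u, v)
      + ∑ j, (u j * cc A y u v j + lw T lam j * v j) * d j
      + (A *ᵥ (u * d)) ⬝ᵥ (A *ᵥ (u * d)) / 2 + ∑ j, lw T lam j / 2 * d j ^ 2 := by
  have e := qF_add A y 0 (u * v) (u * d)
  simp only [qF, qG, zero_dotProduct, add_zero] at e
  rw [hpp_eq, hpp_eq, mul_add, e]
  have e2 : ∑ j, lw T lam j / 2 * (u j ^ 2 + (v + d) j ^ 2) =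
      ∑ j, lw T lam j / 2 * (u j ^ 2 + v j ^ 2) + ∑ j, lw T lam j * v j * d j
        + ∑ j, lw T lam j / 2 * d j ^ 2 := by
    rw [← Finset.sum_add_distrib, ← Finset.sum_add_distrib]
    refine Finset.sum_congr rfl fun j _ => ?_
    simp only [Pi.add_apply]; ring
  have e3 : (Aᵀ *ᵥ (A *ᵥ (u * v) - y)) ⬝ᵥ (u * d) = ∑ j, u j * cc A y u v j * d j := by
    unfold dotProduct cc
    refine Finset.sum_congr rfl fun j _ => ?_
    simp only [Pi.mul_apply]; ring
  rw [e2, e3]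
  simp only [add_mul, Finset.sum_add_distrib]
  ring

theorem lin_zero (a q : ℝ) (h : ∀ t : ℝ, 0 ≤ t * a + t ^ 2 * q) : a = 0 := by
  by_contra ha
  have h1 := h (-a / (1 + |q|))
  have hq : 0 < 1 + |q| := by positivity
  have e : -a / (1 + |q|) * a + (-a / (1 + |q|)) ^ 2 * q
      = a ^ 2 / (1 + |q|) ^ 2 * (q - (1 + |q|)) := by field_simp; ring
  rw [e] at h1
  have : 0 < a ^ 2 / (1 + |q|) ^ 2 := by positivity
  nlinarith [le_abs_self q]

theorem step_lemma {m n : ℕ} (A : Matrix (Fin m) (Fin n) ℝ) (y : Fin m → ℝ)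
    (T : Finset (Fin n)) (lam α : ℝ) (hlam : 0 < lam) (hα : 0 < α) (u v w : Fin n → ℝ)
    (h : ∀ v' : Fin n → ℝ, hppObj A y T lam (u, w) + (∑ i, (w i - v i) ^ 2) / (2 * α)
        ≤ hppObj A y T lam (u, v') + (∑ i, (v' i - v i) ^ 2) / (2 * α)) :
    (∀ j, u j * cc A y u w j + lw T lam j * w j = - ((w j - v j) / α)) ∧
    hppObj A y T lam (u, w) + (A *ᵥ (u * (w - v))) ⬝ᵥ (A *ᵥ (u * (w - v))) / 2
      + (∑ i, (w i - v i) ^ 2) / α ≤ hppObj A y T lam (u, v) := by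
  have h1 : ∀ j, u j * cc A y u w j + lw T lam j * w j = - ((w j - v j) / α) := by
    intro j
    have := lin_zero (u j * cc A y u w j + lw T lam j * w j + (w j - v j) / α)
      ((A *ᵥ (u * Pi.single j 1)) ⬝ᵥ (A *ᵥ (u * Pi.single j 1)) / 2 + lw T lam j / 2
        + 1 / (2 * α)) ?_
    · linarith
    intro t
    have e := h (w + t • Pi.single j 1)
    rw [hpp_add] at e
    have f1 : ∑ i, (u i * cc A y u w i + lw T lam i * w i) * (t • (Pi.single j 1 : Fin n → ℝ)) i
        = t * (u j * cc A y u w j + lw T lam j * w j) := by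
      simp [Pi.single_apply]; ring
    have f2 : ∑ i, lw T lam i / 2 * (t • (Pi.single j 1 : Fin n → ℝ)) i ^ 2
        = t ^ 2 * (lw T lam j / 2) := by
      simp [Pi.single_apply]; ring
    have f3 : ∑ i, ((w + t • (Pi.single j 1 : Fin n → ℝ)) i - v i) ^ 2
        = ∑ i, (w i - v i) ^ 2 + 2 * t * (w j - v j) + t ^ 2 := by
      have : ∀ i, ((w + t • (Pi.single j 1 : Fin n → ℝ)) i - v i) ^ 2 = (w i - v i) ^ 2
        + (if i = j then 2 * t * (w i - v i) + t ^ 2 else 0) := by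
        intro i
        by_cases hi : i = j
        · subst hi; simp; ring
        · simp [hi]
      simp only [this, Finset.sum_add_distrib]
      simp; ring
    have f4 : (A *ᵥ (u * t • (Pi.single j 1 : Fin n → ℝ))) ⬝ᵥ
        (A *ᵥ (u * t • (Pi.single j 1 : Fin n → ℝ)))
        = t ^ 2 * ((A *ᵥ (u * Pi.single j 1)) ⬝ᵥ (A *ᵥ (u * Pi.single j 1))) := by
      rw [mul_smul_comm, Matrix.mulVec_smul, smul_dotProduct, dotProduct_smul]
      simp only [smul_eq_mul]; ring
    rw [f1, f2, f3, f4] at e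
    have f5 : (∑ i, (w i - v i) ^ 2 + 2 * t * (w j - v j) + t ^ 2) / (2 * α) =
      (∑ i, (w i - v i) ^ 2) / (2 * α) + t * ((w j - v j) / α) + t ^ 2 * (1 / (2 * α)) := by
      field_simp
    rw [f5] at e
    linarith
  refine ⟨h1, ?_⟩
  have e := hpp_add A y T lam u w (-(w - v))
  rw [show w + -(w - v) = v by abel] at e
  rw [e]
  simp only [h1]
  have f1 : ∑ j, -((w j - v j) / α) * (-(w - v)) j = (∑ i, (w i - v i) ^ 2) / α := by
    rw [Finset.sum_div]
    refine Finset.sum_congr rfl fun j _ => ?_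
    simp only [Pi.neg_apply, Pi.sub_apply]; ring
  have f2 : 0 ≤ ∑ j, lw T lam j / 2 * (-(w - v)) j ^ 2 := by
    refine Finset.sum_nonneg fun j _ => ?_
    have : 0 ≤ lw T lam j := by unfold lw; split_ifs <;> linarith
    positivity
  rw [f1, mul_neg, Matrix.mulVec_neg, neg_dotProduct_neg]
  linarith

noncomputable def BB {m n : ℕ} (A : Matrix (Fin m) (Fin n) ℝ) :
    Matrix (Fin m) (Fin n ⊕ Fin n) ℝ :=
  Matrix.fromCols ((1/4 : ℝ) • A) (-((1/4 : ℝ) • A))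

noncomputable def ll {n : ℕ} (T : Finset (Fin n)) (lam : ℝ) : Fin n ⊕ Fin n → ℝ :=
  Sum.elim (fun j => lw T lam j / 4) (fun j => lw T lam j / 4)

theorem BB_mulVec {m n : ℕ} (A : Matrix (Fin m) (Fin n) ℝ) (u v : Fin n → ℝ) :
    BB A *ᵥ (Sum.elim ((u + v) ^ 2) ((u - v) ^ 2)) = A *ᵥ (u * v) := by
  unfold BB
  rw [Matrix.fromCols_mulVec_sumElim, Matrix.neg_mulVec, Matrix.smul_mulVec, Matrix.smul_mulVec,
    ← smul_neg, ← smul_add, ← Matrix.mulVec_neg, ← Matrix.mulVec_add, ← Matrix.mulVec_smul]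
  congr 1
  ext j
  simp; ring

theorem qF_bridge {m n : ℕ} (A : Matrix (Fin m) (Fin n) ℝ) (y : Fin m → ℝ)
    (T : Finset (Fin n)) (lam : ℝ) (u v : Fin n → ℝ) :
    qF (BB A) y (ll T lam) (Sum.elim ((u + v) ^ 2) ((u - v) ^ 2)) = hppObj A y T lam (u, v) := by
  rw [hpp_eq, qF, BB_mulVec]
  congr 1
  simp only [dotProduct, Fintype.sum_sum_type, ll, Sum.elim_inl, Sum.elim_inr]
  rw [← Finset.sum_add_distrib]
  refine Finset.sum_congr rfl fun j _ => ?_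
  simp; ring

theorem qG_bridge {m n : ℕ} (A : Matrix (Fin m) (Fin n) ℝ) (y : Fin m → ℝ)
    (T : Finset (Fin n)) (lam : ℝ) (u v : Fin n → ℝ) :
    qG (BB A) y (ll T lam) (Sum.elim ((u + v) ^ 2) ((u - v) ^ 2)) =
      Sum.elim (fun j => (lw T lam j + cc A y u v j) / 4)
        (fun j => (lw T lam j - cc A y u v j) / 4) := by
  rw [qG, BB_mulVec]
  unfold BB ll cc
  rw [Matrix.transpose_fromCols, Matrix.fromRows_mulVec]
  ext j
  rcases j with j | j
  · simp [Matrix.smul_mulVec]; ring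
  · simp [Matrix.smul_mulVec, Matrix.neg_mulVec]; ring

theorem sq_le_sum {n : ℕ} (d : Fin n → ℝ) (c : ℝ) (hc : 0 ≤ c) (h : ∑ i, d i ^ 2 ≤ c ^ 2) :
    ‖d‖ ≤ c := by
  refine (pi_norm_le_iff_of_nonneg hc).2 fun i => ?_
  have := Finset.single_le_sum (f := fun i => d i ^ 2) (fun i _ => sq_nonneg _) (Finset.mem_univ i)
  exact abs_le_of_sq_le_sq (this.trans h) hc

theorem crit_of_min {m n : ℕ} (A : Matrix (Fin m) (Fin n) ℝ) (y : Fin m → ℝ)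
    (T : Finset (Fin n)) (lam : ℝ) (u v : Fin n → ℝ)
    (h1 : ∀ j, u j * cc A y u v j + lw T lam j * v j = 0)
    (h2 : ∀ j, v j * cc A y v u j + lw T lam j * u j = 0) :
    fderiv ℝ (hppObj A y T lam) (u, v) = 0 := by
  have hd : DifferentiableAt ℝ (hppObj A y T lam) (u, v) := by
    unfold hppObj Matrix.mulVec dotProduct
    fun_prop
  have line : ∀ (f : ℝ → ℝ) (a q : ℝ), (∀ t, f t = a + t ^ 2 * q) → HasDerivAt f 0 0 := by
    intro f a q hf
    have : f = fun t => a + t ^ 2 * q := funext hf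
    rw [this]
    have := (((hasDerivAt_id (0:ℝ)).pow 2).mul_const q).const_add a
    simpa using this
  have hv : ∀ d, fderiv ℝ (hppObj A y T lam) (u, v) (0, d) = 0 := by
    intro d
    have e := hd.hasFDerivAt.hasLineDerivAt (0, d)
    refine HasDerivAt.unique e (line _ (hppObj A y T lam (u, v))
      ((A *ᵥ (u * d)) ⬝ᵥ (A *ᵥ (u * d)) / 2 + ∑ j, lw T lam j / 2 * d j ^ 2) fun t => ?_)
    have : (u, v) + t • ((0 : Fin n → ℝ), d) = (u, v + t • d) := by simp
    rw [this, hpp_add]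
    simp only [h1, zero_mul, Finset.sum_const_zero]
    rw [mul_smul_comm, Matrix.mulVec_smul, smul_dotProduct, dotProduct_smul]
    simp only [smul_eq_mul, Pi.smul_apply, mul_add, Finset.mul_sum]
    have : ∀ j, lw T lam j / 2 * (t * d j) ^ 2 = t ^ 2 * (lw T lam j / 2 * d j ^ 2) :=
      fun j => by ring
    simp only [this]
    ring
  have hu : ∀ d, fderiv ℝ (hppObj A y T lam) (u, v) (d, 0) = 0 := by
    intro d
    have e := hd.hasFDerivAt.hasLineDerivAt (d, 0)
    refine HasDerivAt.unique e (line _ (hppObj A y T lam (v, u))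
      ((A *ᵥ (v * d)) ⬝ᵥ (A *ᵥ (v * d)) / 2 + ∑ j, lw T lam j / 2 * d j ^ 2) fun t => ?_)
    have : (u, v) + t • (d, (0 : Fin n → ℝ)) = (u + t • d, v) := by simp
    rw [this, hpp_symm, hpp_add]
    simp only [h2, zero_mul, Finset.sum_const_zero]
    rw [mul_smul_comm, Matrix.mulVec_smul, smul_dotProduct, dotProduct_smul]
    simp only [smul_eq_mul, Pi.smul_apply, mul_add, Finset.mul_sum]
    have : ∀ j, lw T lam j / 2 * (t * d j) ^ 2 = t ^ 2 * (lw T lam j / 2 * d j ^ 2) :=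
      fun j => by ring
    simp only [this]
    ring
  refine ContinuousLinearMap.ext fun d => ?_
  have : d = (d.1, 0) + (0, d.2) := by simp
  rw [this, map_add, hu, hv]
  simp

theorem hpp_cont {m n : ℕ} (A : Matrix (Fin m) (Fin n) ℝ) (y : Fin m → ℝ)
    (T : Finset (Fin n)) (lam : ℝ) : Continuous (hppObj A y T lam) := by
  unfold hppObj Matrix.mulVec dotProduct
  fun_prop

theorem lim_lemma {m n : ℕ} (A : Matrix (Fin m) (Fin n) ℝ) (y : Fin m → ℝ)
    (T : Finset (Fin n)) (lam α : ℝ) (a b : ℕ → (Fin n → ℝ)) (as bs : Fin n → ℝ)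
    (ha : Filter.Tendsto a Filter.atTop (nhds as)) (hb : Filter.Tendsto b Filter.atTop (nhds bs)) :
    Filter.Tendsto (fun k => hppObj A y T lam (a k, b k)) Filter.atTop
        (nhds (hppObj A y T lam (as, bs))) ∧
      Filter.Tendsto (fun k => (∑ i, (a k i - b k i) ^ 2) / (2 * α)) Filter.atTop
        (nhds ((∑ i, (as i - bs i) ^ 2) / (2 * α))) := by
  have hp : Filter.Tendsto (fun k => (a k, b k)) Filter.atTop (nhds (as, bs)) :=
    ha.prodMk_nhds hb
  have h1 := (hpp_cont A y T lam).tendsto (as, bs)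
  constructor
  · exact Filter.Tendsto.comp h1 hp
  · exact (tendsto_finsetSum _ fun i _ =>
      ((tendsto_pi_nhds.1 ha i).sub (tendsto_pi_nhds.1 hb i)).pow 2).div_const _

set_option maxHeartbeats 1000000 in
theorem stmt17 {m n : ℕ} (A : Matrix (Fin m) (Fin n) ℝ) (hrank : A.rank = m)
    (y : Fin m → ℝ) (T : Finset (Fin n)) (hT : T.card ≤ m)
    (lam α : ℝ) (hlam : 0 < lam) (hα : 0 < α)
    (u v : ℕ → (Fin n → ℝ))
    -- proximal alternating minimization iterates
    (hu : ∀ k : ℕ, ∀ u' : Fin n → ℝ,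
      hppObj A y T lam (u (k + 1), v k) + (∑ i, (u (k + 1) i - u k i) ^ 2) / (2 * α)
        ≤ hppObj A y T lam (u', v k) + (∑ i, (u' i - u k i) ^ 2) / (2 * α))
    (hv : ∀ k : ℕ, ∀ v' : Fin n → ℝ,
      hppObj A y T lam (u (k + 1), v (k + 1)) + (∑ i, (v (k + 1) i - v k i) ^ 2) / (2 * α)
        ≤ hppObj A y T lam (u (k + 1), v') + (∑ i, (v' i - v k i) ^ 2) / (2 * α)) :
    ∃ pstar : (Fin n → ℝ) × (Fin n → ℝ),
      Filter.Tendsto (fun k => (u k, v k)) Filter.atTop (nhds pstar) ∧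
      fderiv ℝ (hppObj A y T lam) pstar = 0 := by
  have hSv := fun k => step_lemma A y T lam α hlam hα (u (k+1)) (v k) (v (k+1)) (hv k)
  have hSu := fun k => step_lemma A y T lam α hlam hα (v k) (u k) (u (k+1)) (fun u' => by
    rw [hpp_symm A y T lam (v k), hpp_symm A y T lam (v k)]; exact hu k u')
  obtain ⟨g, hg⟩ : ∃ g : ℕ → ℝ, ∀ k, g k = hppObj A y T lam (u k, v k) := ⟨_, fun k => rfl⟩
  have hdesc : ∀ k, g (k+1)
      + (A *ᵥ (u (k+1) * (v (k+1) - v k))) ⬝ᵥ (A *ᵥ (u (k+1) * (v (k+1) - v k))) / 2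
      + (∑ i, (v (k+1) i - v k i) ^ 2) / α + (∑ i, (u (k+1) i - u k i) ^ 2) / α ≤ g k := by
    intro k
    have e1 := (hSv k).2
    have e2 := (hSu k).2
    rw [hpp_symm A y T lam (v k), hpp_symm A y T lam (v k)] at e2
    rw [hg, hg]
    have : 0 ≤ (A *ᵥ (v k * (u (k+1) - u k))) ⬝ᵥ (A *ᵥ (v k * (u (k+1) - u k))) :=
      Finset.sum_nonneg fun i _ => mul_self_nonneg _
    linarith
  have hn1 : ∀ k, 0 ≤ (∑ i, (v (k+1) i - v k i) ^ 2) / α := fun k =>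
    div_nonneg (Finset.sum_nonneg fun i _ => sq_nonneg _) hα.le
  have hn2 : ∀ k, 0 ≤ (∑ i, (u (k+1) i - u k i) ^ 2) / α := fun k =>
    div_nonneg (Finset.sum_nonneg fun i _ => sq_nonneg _) hα.le
  have hn3 : ∀ k, 0 ≤ (A *ᵥ (u (k+1) * (v (k+1) - v k))) ⬝ᵥ
      (A *ᵥ (u (k+1) * (v (k+1) - v k))) := fun k =>
    Finset.sum_nonneg fun i _ => mul_self_nonneg _
  have hmono : Antitone g := antitone_nat_of_succ_le fun k => by
    linarith [hdesc k, hn1 k, hn2 k, hn3 k]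
  have hlw : ∀ j, 0 ≤ lw T lam j ∧ lw T lam j ≤ lam := fun j => by
    unfold lw; split_ifs <;> constructor <;> linarith
  have hres : ∀ k, (∑ i, ((A *ᵥ (u k * v k)) i - y i) ^ 2) / 2 ≤ g k := by
    intro k
    rw [hg, hpp_eq]
    have : 0 ≤ ∑ j, lw T lam j / 2 * (u k j ^ 2 + v k j ^ 2) :=
      Finset.sum_nonneg fun j _ => by have := (hlw j).1; positivity
    linarith
  have hg0 : ∀ k, 0 ≤ g k := fun k =>
    le_trans (div_nonneg (Finset.sum_nonneg fun i _ => sq_nonneg _) (by norm_num)) (hres k)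
  obtain ⟨ginf, hginf⟩ : ∃ ginf, Filter.Tendsto g Filter.atTop (nhds ginf) :=
    ⟨_, tendsto_atTop_ciInf hmono ⟨0, by rintro _ ⟨k, rfl⟩; exact hg0 k⟩⟩
  have hge : ∀ k, ginf ≤ g k := fun k => hmono.le_of_tendsto hginf k
  -- step sizes
  obtain ⟨D, hDd⟩ : ∃ D : ℕ → ℝ, ∀ k, D k = Real.sqrt (g k - g (k+1)) := ⟨_, fun k => rfl⟩
  have hD0 : ∀ k, 0 ≤ D k := fun k => by rw [hDd]; exact Real.sqrt_nonneg _
  have hD2 : ∀ k, D k ^ 2 = g k - g (k+1) := fun k => by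
    rw [hDd]; exact Real.sq_sqrt (sub_nonneg.2 (hmono (Nat.le_succ k)))
  have hsα : Real.sqrt α ^ 2 = α := Real.sq_sqrt hα.le
  have hdu : ∀ k, ‖u (k+1) - u k‖ ≤ Real.sqrt α * D k := by
    intro k
    refine sq_le_sum _ _ (mul_nonneg (Real.sqrt_nonneg _) (hD0 k)) ?_
    rw [mul_pow, hsα, hD2]
    have : (∑ i, (u (k+1) i - u k i) ^ 2) / α ≤ g k - g (k+1) := by
      linarith [hdesc k, hn1 k, hn2 k, hn3 k]
    rw [div_le_iff₀ hα] at this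
    simp only [Pi.sub_apply]; linarith
  have hdv : ∀ k, ‖v (k+1) - v k‖ ≤ Real.sqrt α * D k := by
    intro k
    refine sq_le_sum _ _ (mul_nonneg (Real.sqrt_nonneg _) (hD0 k)) ?_
    rw [mul_pow, hsα, hD2]
    have : (∑ i, (v (k+1) i - v k i) ^ 2) / α ≤ g k - g (k+1) := by
      linarith [hdesc k, hn1 k, hn2 k, hn3 k]
    rw [div_le_iff₀ hα] at this
    simp only [Pi.sub_apply]; linarith
  have hdA : ∀ k, ‖A *ᵥ (u (k+1) * (v (k+1) - v k))‖ ≤ 2 * D k := by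
    intro k
    refine sq_le_sum _ _ (mul_nonneg (by norm_num) (hD0 k)) ?_
    rw [mul_pow, hD2]
    have e : (A *ᵥ (u (k+1) * (v (k+1) - v k))) ⬝ᵥ (A *ᵥ (u (k+1) * (v (k+1) - v k)))
      = ∑ i, (A *ᵥ (u (k+1) * (v (k+1) - v k))) i ^ 2 :=
      Finset.sum_congr rfl fun i _ => by ring
    have := hdesc k
    have h3 := hn3 k
    rw [e] at this h3
    linarith [hn1 k, hn2 k, hge k, hmono (Nat.le_succ k)]
  obtain ⟨Ka, hKa0, hKa⟩ := mulVec_bd Aᵀ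
  have hcb : ∀ k j, |cc A y (u k) (v k) j| ≤ Ka * Real.sqrt (2 * g 0) := by
    intro k j
    refine (norm_le_pi_norm (cc A y (u k) (v k)) j).trans ((hKa _).trans ?_)
    refine mul_le_mul_of_nonneg_left (sq_le_sum _ _ (Real.sqrt_nonneg _) ?_) hKa0
    rw [Real.sq_sqrt (by linarith [hg0 0])]
    have e1 := hres k
    have e2 := hmono (Nat.zero_le k)
    simp only [Pi.sub_apply]
    linarith
  set Kc := Ka * Real.sqrt (2 * g 0) with hKc
  have hKc0 : 0 ≤ Kc := by positivity
  have hccd : ∀ k j, |cc A y (u (k+1)) (v (k+1)) j - cc A y (u (k+1)) (v k) j|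
      ≤ Ka * (2 * D k) := by
    intro k j
    have e : cc A y (u (k+1)) (v (k+1)) - cc A y (u (k+1)) (v k)
        = Aᵀ *ᵥ (A *ᵥ (u (k+1) * (v (k+1) - v k))) := by
      unfold cc
      rw [← Matrix.mulVec_sub, sub_sub_sub_cancel_right, ← Matrix.mulVec_sub, mul_sub]
    have e2 := norm_le_pi_norm (cc A y (u (k+1)) (v (k+1)) - cc A y (u (k+1)) (v k)) j
    rw [e] at e2
    have e3 := e2.trans ((hKa _).trans (mul_le_mul_of_nonneg_left (hdA k) hKa0))
    rw [← e] at e3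
    exact e3
  obtain ⟨M, hM⟩ : ∃ M : ℕ → ℝ, ∀ k, M k = 1 + ‖u k‖ + ‖v k‖ := ⟨_, fun k => rfl⟩
  have hM1 : ∀ k, 1 ≤ M k := fun k => by
    rw [hM]; have := norm_nonneg (u k); have := norm_nonneg (v k); linarith
  set sα := Real.sqrt α with hsαd
  have hsα0 : 0 ≤ sα := Real.sqrt_nonneg _
  set K1 := sα / α + sα * Kc + 2 * Ka with hK1
  have hK10 : 0 ≤ K1 := by positivity
  have hgv : ∀ k j, |u (k+1) j * cc A y (u (k+1)) (v (k+1)) j + lw T lam j * v (k+1) j|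
      ≤ K1 * (M k * D k) := by
    intro k j
    rw [(hSv k).1 j, abs_neg, abs_div, abs_of_pos hα]
    have e1 : |v (k+1) j - v k j| ≤ sα * D k :=
      (norm_le_pi_norm (v (k+1) - v k) j).trans (hdv k)
    have e2 : |v (k+1) j - v k j| / α ≤ sα / α * D k := by
      rw [div_mul_eq_mul_div]; gcongr
    have e3 : sα / α * D k ≤ K1 * (M k * D k) := by
      have := hD0 k
      have f1 : D k ≤ M k * D k := le_mul_of_one_le_left this (hM1 k)
      have f2 : sα / α ≤ K1 := by
        have : 0 ≤ sα * Kc := by positivity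
        linarith
      have : 0 ≤ sα / α := by positivity
      exact mul_le_mul f2 f1 (hD0 k) hK10
    linarith
  have hgu : ∀ k j, |v (k+1) j * cc A y (u (k+1)) (v (k+1)) j + lw T lam j * u (k+1) j|
      ≤ K1 * (M k * D k) := by
    intro k j
    have e0 := (hSu k).1 j
    rw [cc_symm] at e0
    have e : v (k+1) j * cc A y (u (k+1)) (v (k+1)) j + lw T lam j * u (k+1) j
        = -((u (k+1) j - u k j) / α)
          + (v (k+1) j - v k j) * cc A y (u (k+1)) (v (k+1)) j
          + v k j * (cc A y (u (k+1)) (v (k+1)) j - cc A y (u (k+1)) (v k) j) := by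
      rw [← e0]; ring
    rw [e]
    have e1 : |u (k+1) j - u k j| ≤ sα * D k :=
      (norm_le_pi_norm (u (k+1) - u k) j).trans (hdu k)
    have e2 : |v (k+1) j - v k j| ≤ sα * D k :=
      (norm_le_pi_norm (v (k+1) - v k) j).trans (hdv k)
    have e3 : |v k j| ≤ M k := by
      have := norm_le_pi_norm (v k) j
      rw [Real.norm_eq_abs] at this
      rw [hM]; linarith [norm_nonneg (u k)]
    have f1 : |-((u (k+1) j - u k j) / α)| ≤ sα / α * D k := by
      rw [abs_neg, abs_div, abs_of_pos hα, div_mul_eq_mul_div]; gcongr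
    have f2 : |(v (k+1) j - v k j) * cc A y (u (k+1)) (v (k+1)) j| ≤ sα * D k * Kc := by
      rw [abs_mul]
      exact mul_le_mul e2 (hcb (k+1) j) (abs_nonneg _) (mul_nonneg hsα0 (hD0 k))
    have f3 : |v k j * (cc A y (u (k+1)) (v (k+1)) j - cc A y (u (k+1)) (v k) j)|
        ≤ M k * (Ka * (2 * D k)) := by
      rw [abs_mul]
      exact mul_le_mul e3 (hccd k j) (abs_nonneg _) (by linarith [hM1 k])
    have f4 : D k ≤ M k * D k := le_mul_of_one_le_left (hD0 k) (hM1 k)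
    have f5 : sα / α * D k ≤ sα / α * (M k * D k) := by gcongr
    have f6 : sα * Kc * D k ≤ sα * Kc * (M k * D k) := by gcongr
    refine (abs_add_three _ _ _).trans ?_
    rw [hK1]
    linarith
  -- KL
  obtain ⟨C, σ, hC, hσ, hKL⟩ := kl_main (BB A) y (ll T lam) ginf (lam + Kc) (by positivity)
  obtain ⟨N, hN⟩ : ∃ N, ∀ k ≥ N, g k ≤ ginf + σ := by
    have := hginf.eventually (ge_mem_nhds (show ginf < ginf + σ by linarith))
    exact Filter.eventually_atTop.1 this
  obtain ⟨t, ht⟩ : ∃ t : ℕ → ℝ, ∀ k, t k = Real.sqrt (Real.sqrt (g k - ginf)) :=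
    ⟨_, fun k => rfl⟩
  have ht0 : ∀ k, 0 ≤ t k := fun k => by rw [ht]; exact Real.sqrt_nonneg _
  have ht4 : ∀ k, t k ^ 4 = g k - ginf := fun k => by
    rw [ht, show 4 = 2 * 2 from rfl, pow_mul, Real.sq_sqrt (Real.sqrt_nonneg _),
      Real.sq_sqrt (sub_nonneg.2 (hge k))]
  have hkl : ∀ k ≥ N, t (k+1) ^ 3 ≤ C ^ 3 * K1 * (M k * D k) := by
    intro k hk
    have hε : 0 ≤ K1 * (M k * D k) := mul_nonneg hK10 (mul_nonneg (by linarith [hM1 k]) (hD0 k))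
    obtain ⟨η, hη0, hη⟩ : ∃ η : ℝ, 0 ≤ η ∧ η ^ 3 = K1 * (M k * D k) := by
      refine ⟨(K1 * (M k * D k)) ^ ((3 : ℕ) : ℝ)⁻¹, Real.rpow_nonneg hε _, ?_⟩
      exact Real.rpow_inv_natCast_pow hε (by norm_num)
    have e := hKL (Sum.elim (u (k+1) + v (k+1)) (u (k+1) - v (k+1)))
      (Sum.elim ((u (k+1) + v (k+1)) ^ 2) ((u (k+1) - v (k+1)) ^ 2)) η hη0 ?_ ?_ ?_ ?_
    · rw [qF_bridge, ← hg, ← ht4] at e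
      have hCη : t (k+1) ^ 4 ≤ (C * η) ^ 4 := by
        rw [mul_pow]
        refine e.trans (mul_le_mul_of_nonneg_right ?_ (by positivity))
        exact le_self_pow₀ hC (by norm_num)
      have h1 := le_of_pow_le_pow_left₀ (by norm_num) (by positivity) hCη
      have h2 := pow_le_pow_left₀ (ht0 (k+1)) h1 3
      rw [mul_pow, hη] at h2
      linarith
    · rintro (j | j) <;> simp
    · rw [qG_bridge, hη]
      have hU := fun j => abs_le.1 (hgu k j)
      have hV := fun j => abs_le.1 (hgv k j)
      rintro (j | j)
      · simp only [Sum.elim_inl, Pi.add_apply]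
        rw [abs_le]
        constructor <;> nlinarith [hU j, hV j]
      · simp only [Sum.elim_inr, Pi.sub_apply]
        rw [abs_le]
        constructor <;> nlinarith [hU j, hV j]
    · rw [qG_bridge]
      refine (pi_norm_le_iff_of_nonneg (by positivity)).2 ?_
      have hb := fun j => abs_le.1 (hcb (k+1) j)
      rintro (j | j)
      · simp only [Sum.elim_inl, Real.norm_eq_abs]
        rw [abs_le]
        constructor <;> linarith [hb j, (hlw j).1, (hlw j).2, (hb j).1, (hb j).2]
      · simp only [Sum.elim_inr, Real.norm_eq_abs]
        rw [abs_le]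
        constructor <;> linarith [hb j, (hlw j).1, (hlw j).2, (hb j).1, (hb j).2]
    · rw [qF_bridge, ← hg]
      exact hN _ (by omega)
  set K := 2 * sα + C ^ 3 * K1 with hK
  have hC3 : 0 ≤ C ^ 3 * K1 := by positivity
  have hK0 : 0 ≤ K := by positivity
  have hMb : ∀ k, |M (k+1) - M k| ≤ K * D k := by
    intro k
    have e1 := (abs_norm_sub_norm_le (u (k+1)) (u k)).trans (hdu k)
    have e2 := (abs_norm_sub_norm_le (v (k+1)) (v k)).trans (hdv k)
    have e3 : 0 ≤ C ^ 3 * K1 * D k := mul_nonneg hC3 (hD0 k)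
    rw [abs_le] at e1 e2 ⊢
    rw [hM, hM, hK]
    constructor <;> nlinarith [e1.1, e1.2, e2.1, e2.2]
  have hsum : Summable D := by
    rw [← summable_nat_add_iff N]
    refine seq_lemma (fun k => D (k + N)) (fun k => t (k + N)) (fun k => M (k + N)) K hK0
      (fun k => hD0 _) (fun k => ht0 _) (fun k => by linarith [hM1 (k + N)]) ?_ ?_ ?_ ?_
    · intro k
      simp only [show k + 1 + N = k + N + 1 by ring]
      rw [hD2, ht4, ht4]; linarith
    · intro k
      simp only [show k + 1 + N = k + N + 1 by ring]
      linarith [(abs_le.1 (hMb (k + N))).2]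
    · intro k
      simp only [show k + 1 + N = k + N + 1 by ring]
      linarith [(abs_le.1 (hMb (k + N))).1]
    · intro k
      simp only [show k + 1 + N = k + N + 1 by ring]
      refine (hkl (k + N) (by omega)).trans ?_
      have : 0 ≤ M (k + N) * D (k + N) := mul_nonneg (by linarith [hM1 (k + N)]) (hD0 _)
      exact mul_le_mul_of_nonneg_right (by linarith) this
  have hcau : ∀ w : ℕ → (Fin n → ℝ), (∀ k, ‖w (k+1) - w k‖ ≤ sα * D k) →
      ∃ ws, Filter.Tendsto w Filter.atTop (nhds ws) := by
    intro w hw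
    refine cauchySeq_tendsto_of_complete (cauchySeq_of_dist_le_of_summable (fun k => sα * D k)
      (fun k => ?_) (hsum.mul_left sα))
    rw [dist_comm, dist_eq_norm]
    exact hw k
  obtain ⟨us, hus⟩ := hcau u hdu
  obtain ⟨vs, hvs⟩ := hcau v hdv
  have hus1 := hus.comp (Filter.tendsto_add_atTop_nat 1)
  have hvs1 := hvs.comp (Filter.tendsto_add_atTop_nat 1)
  refine ⟨(us, vs), hus.prodMk_nhds hvs, ?_⟩
  have hV := step_lemma A y T lam α hlam hα us vs vs (fun v' =>
    le_of_tendsto_of_tendsto' ((lim_lemma A y T lam α _ _ _ _ hus1 hvs1).1.add (lim_lemma A y T lam α _ _ _ _ hvs1 hvs).2)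
      ((lim_lemma A y T lam α _ _ _ _ hus1 tendsto_const_nhds).1.add (lim_lemma A y T lam α _ _ _ _ tendsto_const_nhds hvs).2)
      (fun k => hv k v'))
  have hU := step_lemma A y T lam α hlam hα vs us us (fun u' => by
    rw [hpp_symm A y T lam vs, hpp_symm A y T lam vs]
    exact le_of_tendsto_of_tendsto' ((lim_lemma A y T lam α _ _ _ _ hus1 hvs).1.add (lim_lemma A y T lam α _ _ _ _ hus1 hus).2)
      ((lim_lemma A y T lam α _ _ _ _ tendsto_const_nhds hvs).1.add (lim_lemma A y T lam α _ _ _ _ tendsto_const_nhds hus).2)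
      (fun k => hu k u'))
  exact crit_of_min A y T lam us vs (fun j => by simpa using hV.1 j) (fun j => by simpa using hU.1 j)
end
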